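/- arXiv:2402.08576 — 9 statements merged into one kernel-verified Lean document; each statement's English description precedes it below -/
import Mathlib

section
/- For every horizon T ≥ 1 and every deterministic online algorithm for the online linear thresholding problem — i.e., every family of functions g_t mapping the history (ω_1, y_1, …, ω_{t-1}, y_{t-1}, ω_t) to a guess g_t ∈ [0,1] — there exist a threshold s ∈ [0,1] and points ω_1, …, ω_T ∈ [0,1] such that, with labels y_t = 1 if ω_t > s and y_t = -1 otherwise, the total utility Σ_{t=1}^T u_OLT(ω_t, g_t) is at most T/2; equivalently, the online-linear-thresholding regret R_OLT(T) = T − Σ_{t=1}^T u_OLT(ω_t, g_t) is at least T/2, i.e., Ω(T). -/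
/-- Utility in the online linear thresholding problem: the learner's guess `g` is the
probability placed on label `1`; the utility is `g` if the true label is `1` and `1 - g`
if the true label is `-1`. -/
noncomputable def uOLT (y : ℤ) (g : ℝ) : ℝ :=
  g * (if y = 1 then 1 else 0) + (1 - g) * (if y = -1 then 1 else 0)

theorem olt_aux
    (g : (t : ℕ) → (Fin t → ℝ) → (Fin t → ℤ) → ℝ → ℝ) (T : ℕ) :
    ∃ a b : ℝ, 0 ≤ a ∧ a < b ∧ b ≤ 1 ∧ ∃ ω : ℕ → ℝ,
      (∀ t < T, ω t ∈ Set.Icc (0 : ℝ) 1 ∧ (ω t ≤ a ∨ b ≤ ω t)) ∧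
      ∀ s, a ≤ s → s < b → ∑ t ∈ Finset.range T,
          uOLT (if s < ω t then 1 else -1)
            (g t (fun i => ω i.1) (fun i => if s < ω i.1 then 1 else -1) (ω t))
        ≤ (T : ℝ) / 2 := by
  induction T with
  | zero => exact ⟨0, 1, le_rfl, one_pos, le_rfl, fun _ => 0, by simp, by simp⟩
  | succ T ih =>
    obtain ⟨a, b, ha, hab, hb, ω, hω, hs⟩ := ih
    obtain ⟨m, hm⟩ : ∃ m, m = (a + b) / 2 := ⟨_, rfl⟩
    have ham : a < m := by linarith
    have hmb : m < b := by linarith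
    obtain ⟨v, hv⟩ : ∃ v : ℕ → ℝ, v = fun t => if t = T then m else ω t := ⟨_, rfl⟩
    have hvT : v T = m := by simp [hv]
    have hvl : ∀ t < T, v t = ω t := fun t ht => by simp [hv, ht.ne]
    obtain ⟨G, hG⟩ : ∃ G, G = g T (fun i => ω i.1)
      (fun i => if a < ω i.1 then 1 else -1) m := ⟨_, rfl⟩
    have key : ∀ s, a ≤ s → s < b →
        uOLT (if s < m then 1 else -1) G ≤ 1 / 2 →
        ∑ t ∈ Finset.range (T + 1),
          uOLT (if s < v t then 1 else -1)
            (g t (fun i => v i.1) (fun i => if s < v i.1 then 1 else -1) (v t))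
        ≤ ((T + 1 : ℕ) : ℝ) / 2 := by
      intro s h1 h2 h3
      rw [Finset.sum_range_succ]
      have e1 : ∑ t ∈ Finset.range T,
          uOLT (if s < v t then 1 else -1)
            (g t (fun i => v i.1) (fun i => if s < v i.1 then 1 else -1) (v t))
          = ∑ t ∈ Finset.range T,
          uOLT (if s < ω t then 1 else -1)
            (g t (fun i => ω i.1) (fun i => if s < ω i.1 then 1 else -1) (ω t)) := by
        apply Finset.sum_congr rfl
        intro t ht
        have ht := Finset.mem_range.1 ht
        have e : ∀ i : Fin t, v i.1 = ω i.1 := fun i => hvl _ (i.2.trans ht)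
        simp only [e, hvl t ht]
      have e2 : (fun i : Fin T => v i.1) = fun i => ω i.1 := by
        funext i; exact hvl _ i.2
      have e3 : (fun i : Fin T => if s < v i.1 then (1 : ℤ) else -1)
          = fun i => if a < ω i.1 then 1 else -1 := by
        funext i
        rw [hvl _ i.2]
        have : s < ω i.1 ↔ a < ω i.1 := by
          rcases (hω _ i.2).2 with h | h
          · constructor <;> intro <;> linarith
          · constructor <;> intro <;> linarith
        simp only [this]
      rw [e1, e2, e3, hvT, ← hG]
      have := hs s h1 h2
      push_cast
      linarith
    have hv1 : ∀ t < T + 1, v t ∈ Set.Icc (0 : ℝ) 1 ∧ (v t ≤ a ∨ b ≤ v t ∨ v t = m) := by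
      intro t ht
      rcases Nat.lt_succ_iff_lt_or_eq.1 ht with h | h
      · rw [hvl t h]
        have := hω t h
        tauto
      · rw [h, hvT]
        exact ⟨⟨by linarith, by linarith⟩, by simp⟩
    by_cases hc : G ≤ 1 / 2
    · refine ⟨a, m, ha, ham, by linarith, v, fun t ht => ⟨(hv1 t ht).1, ?_⟩, fun s h1 h2 => ?_⟩
      · rcases (hv1 t ht).2 with h | h | h
        · exact Or.inl h
        · right; linarith
        · right; linarith
      · apply key s h1 (by linarith)
        simp only [h2, if_true, uOLT]
        norm_num
        linarith
    · refine ⟨m, b, by linarith, hmb, hb, v, fun t ht => ⟨(hv1 t ht).1, ?_⟩, fun s h1 h2 => ?_⟩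
      · rcases (hv1 t ht).2 with h | h | h
        · left; linarith
        · exact Or.inr h
        · left; linarith
      · apply key s (by linarith) h2
        simp only [not_lt.2 h1, if_false, uOLT]
        norm_num
        linarith

/-- **Impossibility of no-regret learning in online linear thresholding.**
For every horizon `T ≥ 1` and every deterministic online algorithm `g` (a family of
functions mapping the history `(ω_1, y_1, …, ω_{t-1}, y_{t-1}, ω_t)` to a guess in `[0,1]`),
there exist a threshold `s ∈ [0,1]` and points `ω_0, …, ω_{T-1} ∈ [0,1]` such that, with
labels `y_t = 1` if `ω_t > s` and `y_t = -1` otherwise, the total utility is at most `T/2`,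
i.e. the regret `T - Σ_t u_OLT(ω_t, g_t)` is at least `T/2 = Ω(T)`. -/
theorem stmt0 (T : ℕ) (hT : 1 ≤ T)
    (g : (t : ℕ) → (Fin t → ℝ) → (Fin t → ℤ) → ℝ → ℝ)
    (hg : ∀ t past_ω past_y x, g t past_ω past_y x ∈ Set.Icc (0 : ℝ) 1) :
    ∃ s ∈ Set.Icc (0 : ℝ) 1, ∃ ω : ℕ → ℝ,
      (∀ t < T, ω t ∈ Set.Icc (0 : ℝ) 1) ∧
      ∑ t ∈ Finset.range T,
          uOLT (if s < ω t then 1 else -1)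
            (g t (fun i => ω i.1) (fun i => if s < ω i.1 then 1 else -1) (ω t))
        ≤ (T : ℝ) / 2 := by
  obtain ⟨a, b, ha, hab, hb, ω, hω, hs⟩ := olt_aux g T
  exact ⟨a, ⟨ha, by linarith⟩, ω, fun t ht => (hω t ht).1, hs a le_rfl hab⟩
end

section
/- Consider the following contextual Stackelberg game instance: contexts lie in Z = [0,1]; there are two leader actions and two follower actions a_1, a_2 and two follower types, where a follower of type j ∈ {1,2} always best-responds by playing a_j regardless of the context and the leader's mixed strategy; the leader's utility is u(z, a_l, a_f) = 1{a_l = a_f}, so a leader mixed strategy x ∈ [0,1]² with x[1] + x[2] = 1 earns expected utility x[f_t] in round t when the follower has type f_t. Then for every horizon T ≥ 1 and every deterministic leader algorithm mapping each history (z_1, f_1, …, z_{t-1}, f_{t-1}, z_t) to a mixed strategy x_t, there exist a threshold s ∈ [0,1] and contexts z_1, …, z_T ∈ [0,1] such that, with follower types f_t = 1 if z_t > s and f_t = 2 otherwise, Σ_{t=1}^T x_t[f_t] ≤ T/2. Since the context-dependent policy that plays the pure action a_1 when z > s and a_2 otherwise earns utility 1 in every round, the leader's contextual Stackelberg regret is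 at least T/2, i.e., Ω(T): no algorithm achieves sublinear regret when both contexts and follower types are adversarial. -/
theorem stmt1_aux
    (alg : (t : ℕ) → (Fin t → ℝ) → (Fin t → Fin 2) → ℝ → (Fin 2 → ℝ))
    (halg : ∀ t past_z past_f z, (∀ j, 0 ≤ alg t past_z past_f z j) ∧
      (∑ j, alg t past_z past_f z j) = 1) (n : ℕ) :
    ∃ (z : ℕ → ℝ) (f : ℕ → Fin 2) (lo hi : ℝ), 0 ≤ lo ∧ lo < hi ∧ hi ≤ 1 ∧
      (∀ t < n, z t ∈ Set.Icc (0 : ℝ) 1) ∧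
      (∀ t < n, (f t = 0 ∧ hi ≤ z t) ∨ (f t = 1 ∧ z t ≤ lo)) ∧
      ∑ t ∈ Finset.range n, alg t (fun i => z i.1) (fun i => f i.1) (z t) (f t) ≤ (n : ℝ) / 2 := by
  induction n with
  | zero => exact ⟨fun _ => 0, fun _ => 0, 0, 1, by simp⟩
  | succ n ih =>
    obtain ⟨z, f, lo, hi, h0, hlt, h1, hz, hf, hs⟩ := ih
    have key : ∀ (m : ℝ) (j : Fin 2),
        alg n (fun i => z i.1) (fun i => f i.1) m j ≤ 1 / 2 →
        ∑ t ∈ Finset.range (n + 1), alg t (fun i => Function.update z n m i.1)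
          (fun i => Function.update f n j i.1) (Function.update z n m t)
          (Function.update f n j t) ≤ ((n + 1 : ℕ) : ℝ) / 2 := by
      intro m j hj
      have e : ∀ t ≤ n, (fun i : Fin t => Function.update z n m i.1) = fun i => z i.1 := by
        intro t ht
        funext i
        exact Function.update_of_ne (by have := i.2; omega) _ _
      have e' : ∀ t ≤ n, (fun i : Fin t => Function.update f n j i.1) = fun i => f i.1 := by
        intro t ht
        funext i
        exact Function.update_of_ne (by have := i.2; omega) _ _
      rw [Finset.sum_range_succ, e n le_rfl, e' n le_rfl, Function.update_self,
        Function.update_self]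
      have : ∑ t ∈ Finset.range n, alg t (fun i => Function.update z n m i.1)
          (fun i => Function.update f n j i.1) (Function.update z n m t)
          (Function.update f n j t) =
          ∑ t ∈ Finset.range n, alg t (fun i => z i.1) (fun i => f i.1) (z t) (f t) := by
        apply Finset.sum_congr rfl
        intro t ht
        have ht' := Finset.mem_range.1 ht
        rw [e t ht'.le, e' t ht'.le, Function.update_of_ne ht'.ne, Function.update_of_ne ht'.ne]
      rw [this]
      push_cast
      linarith
    have hsum := (halg n (fun i => z i.1) (fun i => f i.1) ((lo + hi) / 2)).2
    rw [Fin.sum_univ_two] at hsum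
    have hz' : ∀ t < n + 1, Function.update z n ((lo + hi) / 2) t ∈ Set.Icc (0 : ℝ) 1 := by
      intro t ht
      rcases eq_or_ne t n with rfl | hne
      · rw [Function.update_self]
        constructor <;> linarith
      · rw [Function.update_of_ne hne]
        exact hz t (by omega)
    by_cases hc : alg n (fun i => z i.1) (fun i => f i.1) ((lo + hi) / 2) 0 ≤ 1 / 2
    · refine ⟨Function.update z n ((lo + hi) / 2), Function.update f n 0, lo, (lo + hi) / 2,
        h0, by linarith, by linarith, hz', ?_, key _ _ hc⟩
      intro t ht
      rcases eq_or_ne t n with rfl | hne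
      · simp
      · rw [Function.update_of_ne hne, Function.update_of_ne hne]
        rcases hf t (by omega) with h | h
        · exact Or.inl ⟨h.1, by linarith [h.2]⟩
        · exact Or.inr h
    · refine ⟨Function.update z n ((lo + hi) / 2), Function.update f n 1, (lo + hi) / 2, hi,
        by linarith, by linarith, h1, hz', ?_, key _ _ (by linarith)⟩
      intro t ht
      rcases eq_or_ne t n with rfl | hne
      · simp
      · rw [Function.update_of_ne hne, Function.update_of_ne hne]
        rcases hf t (by omega) with h | h
        · exact Or.inl h
        · exact Or.inr ⟨h.1, by linarith [h.2]⟩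

/-- **Impossibility of fully adversarial no-regret learning in Stackelberg games with side
information.**  In the hard instance, contexts lie in `[0,1]`, there are two leader actions
and two follower types (indexed by `Fin 2`), where a follower of type `j` always plays the
action `a_j` regardless of the context and the leader's mixed strategy, and the leader's
utility is `1{a_l = a_f}`, so a mixed strategy `x` (a probability vector on `Fin 2`) earns
expected utility `x[f_t]` in round `t` against follower type `f_t`.  For every horizon
`T ≥ 1` and every deterministic leader algorithm `alg` mapping each history
`(z_1, f_1, …, z_{t-1}, f_{t-1}, z_t)` to a mixed strategy, there exist a threshold
`s ∈ [0,1]` and contexts `z_1, …, z_T ∈ [0,1]` such that, with follower types `f_t = 0`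
(type 1) if `z_t > s` and `f_t = 1` (type 2) otherwise, the total leader utility
`Σ_t x_t[f_t]` is at most `T/2`.  Since the policy playing the pure action `a_1` when
`z > s` and `a_2` otherwise earns utility `1` every round, the contextual Stackelberg
regret is at least `T/2 = Ω(T)`. -/
theorem stmt1 (T : ℕ) (hT : 1 ≤ T)
    (alg : (t : ℕ) → (Fin t → ℝ) → (Fin t → Fin 2) → ℝ → (Fin 2 → ℝ))
    (halg : ∀ t past_z past_f z, (∀ j, 0 ≤ alg t past_z past_f z j) ∧
      (∑ j, alg t past_z past_f z j) = 1) :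
    ∃ s ∈ Set.Icc (0 : ℝ) 1, ∃ z : ℕ → ℝ,
      (∀ t < T, z t ∈ Set.Icc (0 : ℝ) 1) ∧
      ∑ t ∈ Finset.range T,
          alg t (fun i => z i.1) (fun i => if s < z i.1 then 0 else 1) (z t)
            (if s < z t then 0 else 1)
        ≤ (T : ℝ) / 2 := by
  obtain ⟨z, f, lo, hi, h0, hlt, h1, hz, hf, hs⟩ := stmt1_aux alg halg T
  refine ⟨lo, ⟨h0, by linarith⟩, z, hz, le_trans (le_of_eq ?_) hs⟩
  have e : ∀ t < T, (if lo < z t then (0 : Fin 2) else 1) = f t := by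
    intro t ht
    rcases hf t ht with h | h
    · rw [if_pos (by linarith [h.2]), h.1]
    · rw [if_neg (by linarith [h.2]), h.1]
  apply Finset.sum_congr rfl
  intro t ht
  have ht' := Finset.mem_range.1 ht
  have e' : (fun i : Fin t => if lo < z i.1 then (0 : Fin 2) else 1) = fun i => f i.1 := by
    funext i
    exact e i.1 (i.2.trans ht')
  rw [e', e t ht']
end

section
/- Lemma (restricting to approximate extreme points loses at most δ per round): Let δ > 0 and let (E_z)_{z ∈ Z} be a δ-approximate extreme point family. Then for every horizon T, every sequence of follower types f_1, …, f_T ∈ {1, …, K}, every sequence of contexts z_1, …, z_T ∈ Z, and every policy π : Z → Δ(A), there exists a policy π^(E) : Z → Δ(A) with π^(E)(z) ∈ E_z for all z such that Σ_{t=1}^T [u(z_t, π(z_t), b_{f_t}(z_t, π(z_t))) − u(z_t, π^(E)(z_t), b_{f_t}(z_t, π^(E)(z_t)))] ≤ δ·T. In particular, if δ ≤ 1/T the total deficit is at most 1. Moreover, the same bound holds when the sums are replaced by expectations over follower types drawn from any fixed distribution over {1, …, K}. -/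
open Finset

lemma exists_extreme_max {A : Type*} [Fintype A] (C : Set (A → ℝ)) (hC : IsCompact C)
    (hne : C.Nonempty) (c : A → ℝ) :
    ∃ y ∈ Set.extremePoints ℝ C, ∀ x ∈ C, ∑ a, x a * c a ≤ ∑ a, y a * c a := by
  let L : StrongDual ℝ (A → ℝ) := ∑ a, (c a) • (ContinuousLinearMap.proj (R := ℝ) (φ := fun _ : A => ℝ) a)
  have hL : ∀ x, L x = ∑ a, x a * c a := by
    intro x
    simp [L, mul_comm]
  have hexp : IsExposed ℝ C (L.toExposed C) := ContinuousLinearMap.toExposed.isExposed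
  have hcomp : IsCompact (L.toExposed C) := hexp.isCompact hC
  obtain ⟨m, hm, hmax⟩ := hC.exists_isMaxOn hne L.continuous.continuousOn
  have hn : (L.toExposed C).Nonempty := ⟨m, hm, fun x hx => hmax hx⟩
  obtain ⟨y, hy⟩ := hcomp.extremePoints_nonempty hn
  refine ⟨y, hexp.isExtreme.extremePoints_subset_extremePoints hy, fun x hx => ?_⟩
  have := (hy.1).2 x hx
  rwa [hL, hL] at this

lemma key_lemma {A Af ι : Type*} [Fintype A] (K : ℕ) (δ : ℝ) (hδ : 0 < δ)
    (u : A → Af → ℝ) (hu : ∀ a af, u a af ∈ Set.Icc (0 : ℝ) 1)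
    (b : Fin K → (A → ℝ) → Af)
    (E : Set (A → ℝ))
    (hfam : ∀ (σ : Fin K → Af),
      ({x : A → ℝ | ((∀ a, 0 ≤ x a) ∧ ∑ a, x a = 1) ∧ ∀ i, b i x = σ i}).Nonempty →
      ∀ y ∈ Set.extremePoints ℝ
          (closure {x : A → ℝ | ((∀ a, 0 ≤ x a) ∧ ∑ a, x a = 1) ∧ ∀ i, b i x = σ i}),
        (y ∈ {x : A → ℝ | ((∀ a, 0 ≤ x a) ∧ ∑ a, x a = 1) ∧ ∀ i, b i x = σ i} ∧
          y ∈ E) ∨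
        ∃ x' ∈ E ∩ {x : A → ℝ | ((∀ a, 0 ≤ x a) ∧ ∑ a, x a = 1) ∧ ∀ i, b i x = σ i},
          (∑ a, |x' a - y a|) ≤ δ)
    (x : A → ℝ) (hx : (∀ a, 0 ≤ x a) ∧ ∑ a, x a = 1)
    (S : Finset ι) (w : ι → ℝ) (hw : ∀ i, 0 ≤ w i) (g : ι → Fin K) :
    ∃ x' ∈ E, ∑ t ∈ S, w t * ((∑ a, x a * u a (b (g t) x)) - ∑ a, x' a * u a (b (g t) x'))
      ≤ δ * ∑ t ∈ S, w t := by
  set X := {y : A → ℝ | ((∀ a, 0 ≤ y a) ∧ ∑ a, y a = 1) ∧ ∀ i, b i y = b i x} with hX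
  have hxX : x ∈ X := ⟨hx, fun _ => rfl⟩
  have hcomp : IsCompact (closure X) := by
    refine (isCompact_stdSimplex ℝ A).closure_of_subset ?_
    intro y hy
    exact hy.1
  obtain ⟨y, hy, hmax⟩ := exists_extreme_max (closure X) hcomp ⟨x, subset_closure hxX⟩
    (fun a => ∑ t ∈ S, w t * u a (b (g t) x))
  have hsw : ∀ v : A → ℝ, ∑ a, v a * ∑ t ∈ S, w t * u a (b (g t) x)
      = ∑ t ∈ S, w t * ∑ a, v a * u a (b (g t) x) := by
    intro v
    simp_rw [Finset.mul_sum]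
    rw [Finset.sum_comm]
    refine Finset.sum_congr rfl fun t _ => Finset.sum_congr rfl fun a _ => by ring
  have hm := hmax x (subset_closure hxX)
  rw [hsw, hsw] at hm
  have : ∃ x' ∈ E ∩ X, (∑ a, |x' a - y a|) ≤ δ := by
    rcases hfam (fun i => b i x) ⟨x, hxX⟩ y hy with h | h
    · exact ⟨y, ⟨h.2, h.1⟩, by simpa using hδ.le⟩
    · exact h
  obtain ⟨x', ⟨hxE, hx'⟩, hd⟩ := this
  refine ⟨x', hxE, ?_⟩
  have h1 : ∀ t, (∑ a, y a * u a (b (g t) x)) - ∑ a, x' a * u a (b (g t) x) ≤ δ := by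
    intro t
    rw [← Finset.sum_sub_distrib]
    refine le_trans (Finset.sum_le_sum fun a _ => ?_) hd
    have h0 := hu a (b (g t) x)
    rw [← sub_mul, abs_sub_comm]
    calc (y a - x' a) * u a (b (g t) x) ≤ |y a - x' a| * u a (b (g t) x) :=
          mul_le_mul_of_nonneg_right (le_abs_self _) h0.1
      _ ≤ |y a - x' a| * 1 := mul_le_mul_of_nonneg_left h0.2 (abs_nonneg _)
      _ = _ := mul_one _
  have h2 : ∑ t ∈ S, w t * ((∑ a, y a * u a (b (g t) x)) - ∑ a, x' a * u a (b (g t) x))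
      ≤ δ * ∑ t ∈ S, w t := by
    rw [Finset.mul_sum]
    refine Finset.sum_le_sum fun t _ => ?_
    rw [mul_comm δ]
    exact mul_le_mul_of_nonneg_left (h1 t) (hw t)
  have h3 : ∀ t, b (g t) x' = b (g t) x := fun t => hx'.2 _
  simp only [h3]
  simp only [mul_sub, Finset.sum_sub_distrib] at h2 ⊢
  linarith


/-- **Restricting to `δ`-approximate extreme points loses at most `δ` per round.**
Setup: `Z` is an arbitrary context set, `A` a finite leader action set with simplex
`Δ(A) = {x : A → ℝ | x ≥ 0, Σ x = 1}`, `Af` a finite linearly ordered follower action set,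
and there are `K` follower types with utilities `uf i : Z × A × Af → [0,1]`; the leader has
utility `u : Z × A × Af → [0,1]`, extended linearly to mixed strategies.  The best response
`b i z x` of type `i` is the largest maximizer of `Σ_a x a * uf i z a af` (encoded by the
two hypotheses `hb_argmax`, `hb_greatest`), and for `σ : Fin K → Af` the contextual
best-response region is `X_z(σ) = {x ∈ Δ(A) : b i z x = σ i for all i}`.  Let `(E z)` be a
`δ`-approximate extreme point family: for every `z` and every `σ` with `X_z(σ)` nonempty,
every extreme point `y` of `cl(X_z(σ))` either lies in `X_z(σ) ∩ E z`, or there is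
`x' ∈ E z ∩ X_z(σ)` with `‖x' − y‖₁ ≤ δ`.  Then for every horizon `T`, every sequence of
follower types `f`, every sequence of contexts `zs`, and every policy `π : Z → Δ(A)`, there
exists a policy `πE` with `πE z ∈ E z` for all `z` whose total utility deficit relative to
`π` is at most `δ·T`; moreover, the same bound holds when the realized sums over follower
types are replaced by expectations under any fixed distribution `F` over types. -/
theorem stmt3 {Z A Af : Type*} [Fintype A] [Nonempty A] [Fintype Af] [Nonempty Af]
    [LinearOrder Af] (K T : ℕ) (δ : ℝ) (hδ : 0 < δ)
    (uf : Fin K → Z → A → Af → ℝ) (huf : ∀ i z a af, uf i z a af ∈ Set.Icc (0 : ℝ) 1)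
    (u : Z → A → Af → ℝ) (hu : ∀ z a af, u z a af ∈ Set.Icc (0 : ℝ) 1)
    (b : Fin K → Z → (A → ℝ) → Af)
    (hb_argmax : ∀ i z x af, (∑ a, x a * uf i z a af) ≤ ∑ a, x a * uf i z a (b i z x))
    (hb_greatest : ∀ i z x af,
      (∀ af', (∑ a, x a * uf i z a af') ≤ ∑ a, x a * uf i z a af) → af ≤ b i z x)
    (E : Z → Set (A → ℝ))
    (hEΔ : ∀ z, E z ⊆ {x : A → ℝ | (∀ a, 0 ≤ x a) ∧ ∑ a, x a = 1})
    (hfam : ∀ (z : Z) (σ : Fin K → Af),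
      ({x : A → ℝ | ((∀ a, 0 ≤ x a) ∧ ∑ a, x a = 1) ∧ ∀ i, b i z x = σ i}).Nonempty →
      ∀ y ∈ Set.extremePoints ℝ
          (closure {x : A → ℝ | ((∀ a, 0 ≤ x a) ∧ ∑ a, x a = 1) ∧ ∀ i, b i z x = σ i}),
        (y ∈ {x : A → ℝ | ((∀ a, 0 ≤ x a) ∧ ∑ a, x a = 1) ∧ ∀ i, b i z x = σ i} ∧
          y ∈ E z) ∨
        ∃ x' ∈ E z ∩ {x : A → ℝ | ((∀ a, 0 ≤ x a) ∧ ∑ a, x a = 1) ∧ ∀ i, b i z x = σ i},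
          (∑ a, |x' a - y a|) ≤ δ)
    (f : ℕ → Fin K) (zs : ℕ → Z)
    (π : Z → (A → ℝ)) (hπ : ∀ z, (∀ a, 0 ≤ π z a) ∧ ∑ a, π z a = 1) :
    (∃ πE : Z → (A → ℝ), (∀ z, πE z ∈ E z) ∧
      (∑ t ∈ Finset.range T,
        ((∑ a, π (zs t) a * u (zs t) a (b (f t) (zs t) (π (zs t)))) -
         (∑ a, πE (zs t) a * u (zs t) a (b (f t) (zs t) (πE (zs t))))))
        ≤ δ * T) ∧
    (∀ F : Fin K → ℝ, (∀ i, 0 ≤ F i) → (∑ i, F i = 1) →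
      ∃ πE : Z → (A → ℝ), (∀ z, πE z ∈ E z) ∧
      (∑ t ∈ Finset.range T, ∑ i,
        F i * ((∑ a, π (zs t) a * u (zs t) a (b i (zs t) (π (zs t)))) -
               (∑ a, πE (zs t) a * u (zs t) a (b i (zs t) (πE (zs t))))))
        ≤ δ * T) := by
  classical
  refine ⟨?_, ?_⟩
  · have hk := fun z => key_lemma K δ hδ (u z) (hu z) (fun i => b i z) (E z) (hfam z) (π z) (hπ z)
      ((Finset.range T).filter (fun t => zs t = z)) (fun _ => 1) (fun _ => zero_le_one) f
    choose πE hE hs using hk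
    refine ⟨πE, hE, ?_⟩
    have hT : δ * (T : ℝ) = ∑ z ∈ (Finset.range T).image zs,
        δ * ∑ t ∈ (Finset.range T).filter (fun t => zs t = z), (1 : ℝ) := by
      rw [← Finset.mul_sum, Finset.sum_fiberwise_of_maps_to
        (fun t ht => Finset.mem_image_of_mem zs ht)]
      simp
    rw [hT, ← Finset.sum_fiberwise_of_maps_to
        (fun t ht => Finset.mem_image_of_mem zs ht)]
    refine Finset.sum_le_sum fun z _ => le_trans (le_of_eq ?_) (hs z)
    refine Finset.sum_congr rfl fun t ht => ?_
    obtain rfl := (Finset.mem_filter.1 ht).2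
    rw [one_mul]
  · intro F hF hF1
    have hk := fun z => key_lemma K δ hδ (u z) (hu z) (fun i => b i z) (E z) (hfam z) (π z) (hπ z)
      Finset.univ F hF id
    choose πE hE hs using hk
    refine ⟨πE, hE, ?_⟩
    refine le_trans (Finset.sum_le_sum fun t _ => hs (zs t)) ?_
    rw [hF1]
    simp [mul_comm]
end

section
/- Theorem (regret of the greedy algorithm with stochastic follower types and adversarial contexts): Let f_1, …, f_T be i.i.d. random follower types in {1,…,K} with distribution F, and let the contexts be chosen by an adaptive adversary, z_t = ζ_t(f_1, …, f_{t-1}) for fixed functions ζ_t. For each context z, let E_z ⊆ X be a given finite nonempty set, and for each t let p̂_t(z, x) ∈ Δ(A_f) be estimated best-response distributions that are functions only of f_1, …, f_{t-1}. Suppose the leader plays greedily: π_t(z_t) ∈ argmax_{x ∈ E_{z_t}} Σ_{a ∈ A_f} p̂_t(z_t, x)(a)·u(z_t, x, a). Then for every comparator policy ρ with ρ(z) ∈ E_z for all z, E[Σ_{t=1}^T u(z_t, ρ(z_t), b_{f_t}(z_t, ρ(z_t))) − u(z_t, π_t(z_t), b_{f_t}(z_t, π_t(z_t)))] ≤ 2·Σ_{t=1}^T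 E[TV(p(z_t, ρ(z_t)), p̂_t(z_t, ρ(z_t))) + TV(p(z_t, π_t(z_t)), p̂_t(z_t, π_t(z_t)))]. -/
open Finset

/-- Total variation distance `(1/2)·Σ_a |p a − q a|` between two vectors on a finite set. -/
noncomputable def tvDist {Af : Type*} [Fintype Af] (p q : Af → ℝ) : ℝ :=
  (1 / 2) * ∑ a, |p a - q a|

/-- The true best-response distribution: `p(z,x)(a) = P_{i∼q}(b_i(z,x) = a)`. -/
noncomputable def brDist {Z X Af : Type*} [DecidableEq Af] {K : ℕ}
    (q : Fin K → ℝ) (b : Fin K → Z → X → Af) (z : Z) (x : X) (a : Af) : ℝ :=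
  ∑ i, if b i z x = a then q i else 0

theorem resample_aux {K T : ℕ} (q : Fin K → ℝ) (hq1 : ∑ i, q i = 1) (t : Fin T)
    (G : (Fin T → Fin K) → Fin K → ℝ)
    (hG : ∀ ω i, G (Function.update ω t i) = G ω) :
    ∑ ω : Fin T → Fin K, (∏ s, q (ω s)) * G ω (ω t) =
      ∑ ω : Fin T → Fin K, (∏ s, q (ω s)) * ∑ i, q i * G ω i := by
  have hw : ∀ (ω : Fin T → Fin K) i,
      (∏ s, q (Function.update ω t i s)) * q (ω t) = (∏ s, q (ω s)) * q i := by
    intro ω i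
    rw [← Finset.mul_prod_erase univ (fun s => q (Function.update ω t i s)) (mem_univ t),
      ← Finset.mul_prod_erase univ (fun s => q (ω s)) (mem_univ t)]
    have : ∏ s ∈ univ.erase t, q (Function.update ω t i s) = ∏ s ∈ univ.erase t, q (ω s) := by
      apply Finset.prod_congr rfl
      intro s hs
      rw [Function.update_of_ne (Finset.ne_of_mem_erase hs)]
    rw [this]
    simp only [Function.update_self]
    ring
  have h1 : ∑ p : (Fin T → Fin K) × Fin K, (∏ s, q (p.1 s)) * q p.2 * G p.1 (p.1 t) =
      ∑ p : (Fin T → Fin K) × Fin K, (∏ s, q (p.1 s)) * q p.2 * G p.1 p.2 := by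
    refine Finset.sum_nbij' (fun p => (Function.update p.1 t p.2, p.1 t))
      (fun p => (Function.update p.1 t p.2, p.1 t)) (by simp) (by simp) (by simp) (by simp) ?_
    rintro ⟨ω, i⟩ -
    simp only [hw, hG]
  rw [Fintype.sum_prod_type, Fintype.sum_prod_type] at h1
  calc _ = ∑ ω : Fin T → Fin K, ∑ i, (∏ s, q (ω s)) * q i * G ω (ω t) := by
        refine Finset.sum_congr rfl fun ω _ => ?_
        rw [← Finset.sum_mul, ← Finset.mul_sum, hq1, mul_one]
    _ = _ := h1
    _ = _ := by
        refine Finset.sum_congr rfl fun ω _ => ?_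
        rw [Finset.mul_sum]
        exact Finset.sum_congr rfl fun i _ => by ring

theorem brDist_sum {Z X Af : Type*} [Fintype Af] [DecidableEq Af] {K : ℕ}
    (q : Fin K → ℝ) (b : Fin K → Z → X → Af) (z : Z) (x : X) (v : Af → ℝ) :
    ∑ i, q i * v (b i z x) = ∑ a, brDist q b z x a * v a := by
  simp only [brDist, Finset.sum_mul]
  rw [Finset.sum_comm]
  simp [ite_mul]

theorem tv_bound {Af : Type*} [Fintype Af] (p r v : Af → ℝ)
    (hv : ∀ a, v a ∈ Set.Icc (0 : ℝ) 1) :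
    |∑ a, p a * v a - ∑ a, r a * v a| ≤ 2 * tvDist p r := by
  have h : 2 * tvDist p r = ∑ a, |p a - r a| := by unfold tvDist; ring
  rw [h, ← Finset.sum_sub_distrib]
  refine (Finset.abs_sum_le_sum_abs _ _).trans (Finset.sum_le_sum fun a _ => ?_)
  rw [← sub_mul, abs_mul, abs_of_nonneg (hv a).1]
  exact mul_le_of_le_one_right (abs_nonneg _) (hv a).2

/-- **Regret of the greedy algorithm with stochastic follower types and adversarial
contexts.**  The follower types `f_1, …, f_T` are i.i.d. with distribution `q` on
`{1,…,K}` (encoded as the coordinates of `ω : Fin T → Fin K` under the product weight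
`∏ t, q (ω t)`), and the contexts are chosen by an adaptive adversary:
`z t ω` depends only on the coordinates `ω s` for `s < t`.  For each context `z` the set
`E z ⊆ X` is finite and nonempty, and the estimated best-response distributions
`phat t ω z x ∈ Δ(Af)` are functions only of `f_1, …, f_{t−1}`.  The leader plays
greedily: `π t ω ∈ argmax_{x ∈ E (z t ω)} Σ_a phat t ω (z t ω) x a · u (z t ω) x a`.
Then for every comparator policy `ρ` with `ρ z ∈ E z` for all `z`,
`E[Σ_t u(z_t, ρ(z_t), b_{f_t}(z_t, ρ(z_t))) − u(z_t, π_t(z_t), b_{f_t}(z_t, π_t(z_t)))]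
  ≤ 2·Σ_t E[TV(p(z_t, ρ(z_t)), p̂_t(z_t, ρ(z_t))) + TV(p(z_t, π_t(z_t)), p̂_t(z_t, π_t(z_t)))]`. -/
theorem stmt4 {Z X Af : Type*} [Fintype Af] [DecidableEq Af] (K T : ℕ)
    (q : Fin K → ℝ) (hq0 : ∀ i, 0 ≤ q i) (hq1 : ∑ i, q i = 1)
    (b : Fin K → Z → X → Af)
    (u : Z → X → Af → ℝ) (hu : ∀ z x a, u z x a ∈ Set.Icc (0 : ℝ) 1)
    (E : Z → Finset X) (hE : ∀ z, (E z).Nonempty)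
    (z : Fin T → (Fin T → Fin K) → Z)
    (hz_past : ∀ t ω ω', (∀ s, s < t → ω s = ω' s) → z t ω = z t ω')
    (phat : Fin T → (Fin T → Fin K) → Z → X → Af → ℝ)
    (hphat_past : ∀ t ω ω', (∀ s, s < t → ω s = ω' s) → phat t ω = phat t ω')
    (hphat_prob : ∀ t ω zz x, (∀ a, 0 ≤ phat t ω zz x a) ∧ (∑ a, phat t ω zz x a = 1))
    (π : Fin T → (Fin T → Fin K) → X)
    (hπ_past : ∀ t ω ω', (∀ s, s < t → ω s = ω' s) → π t ω = π t ω')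
    (hπ_mem : ∀ t ω, π t ω ∈ E (z t ω))
    (hπ_greedy : ∀ t ω x, x ∈ E (z t ω) →
      (∑ a, phat t ω (z t ω) x a * u (z t ω) x a) ≤
        ∑ a, phat t ω (z t ω) (π t ω) a * u (z t ω) (π t ω) a)
    (ρ : Z → X) (hρ : ∀ zz, ρ zz ∈ E zz) :
    (∑ ω : Fin T → Fin K, (∏ t, q (ω t)) *
        (∑ t, (u (z t ω) (ρ (z t ω)) (b (ω t) (z t ω) (ρ (z t ω))) -
               u (z t ω) (π t ω) (b (ω t) (z t ω) (π t ω)))))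
      ≤ 2 * ∑ ω : Fin T → Fin K, (∏ t, q (ω t)) *
        (∑ t, (tvDist (brDist q b (z t ω) (ρ (z t ω))) (phat t ω (z t ω) (ρ (z t ω))) +
               tvDist (brDist q b (z t ω) (π t ω)) (phat t ω (z t ω) (π t ω)))) := by
  simp only [Finset.mul_sum]
  rw [Finset.sum_comm, Finset.sum_comm (s := (univ : Finset (Fin T → Fin K)))]
  refine Finset.sum_le_sum fun t _ => ?_
  rw [resample_aux q hq1 t (fun ω i => u (z t ω) (ρ (z t ω)) (b i (z t ω) (ρ (z t ω))) -
               u (z t ω) (π t ω) (b i (z t ω) (π t ω)))]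
  · refine Finset.sum_le_sum fun ω _ => ?_
    rw [mul_left_comm]
    refine mul_le_mul_of_nonneg_left ?_ (Finset.prod_nonneg fun s _ => hq0 _)
    simp only [mul_sub, Finset.sum_sub_distrib]
    rw [brDist_sum q b _ _ (u (z t ω) (ρ (z t ω))), brDist_sum q b _ _ (u (z t ω) (π t ω))]
    have h1 := abs_le.1 (tv_bound (brDist q b (z t ω) (ρ (z t ω)))
      (phat t ω (z t ω) (ρ (z t ω))) _ (hu (z t ω) (ρ (z t ω))))
    have h2 := abs_le.1 (tv_bound (brDist q b (z t ω) (π t ω))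
      (phat t ω (z t ω) (π t ω)) _ (hu (z t ω) (π t ω)))
    have h3 := hπ_greedy t ω _ (hρ (z t ω))
    linarith [h1.2, h2.1]
  · intro ω i
    have hs : ∀ s, s < t → Function.update ω t i s = ω s := fun s hs =>
      Function.update_of_ne hs.ne _ _
    rw [hz_past t _ _ hs, hπ_past t _ _ hs]
end

section
/- Corollary (greedy with empirical type frequencies): In the setting of the greedy theorem with stochastic follower types and adversarially (adaptively) chosen contexts, instantiate the estimates by p̂_1(i) = 1/K and p̂_t(i) = (1/(t−1))·Σ_{τ=1}^{t−1} 1{f_τ = i} for t ≥ 2, and set p̂_t(z, x)(a) = Σ_{i=1}^K 1{b_i(z, x) = a}·p̂_t(i). Then there exists an absolute constant C such that for all T ≥ 2 and every comparator policy ρ with ρ(z) ∈ E_z for all z, E[Σ_{t=1}^T u(z_t, ρ(z_t), b_{f_t}(z_t, ρ(z_t))) − u(z_t, π_t(z_t), b_{f_t}(z_t, π_t(z_t)))] ≤ C·K·√(T·log T), i.e., the greedy leader's expected regret is O(K·√(T log T)). -/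
open Finset

/-- Empirical distribution of follower types: at round `t` (0-indexed, so `t = 0` is the
first round) the estimate is uniform `1/K` if no samples have been observed, and otherwise
the empirical frequency of type `i` among the first `t` observed types. -/
noncomputable def empTypeDist (K T : ℕ) (t : Fin T) (ω : Fin T → Fin K) (i : Fin K) : ℝ :=
  if (t : ℕ) = 0 then 1 / (K : ℝ)
  else (1 / ((t : ℕ) : ℝ)) *
    ∑ τ ∈ Finset.univ.filter (fun τ : Fin T => τ < t), (if ω τ = i then (1 : ℝ) else 0)

lemma aux_mass {K T : ℕ} (q : Fin K → ℝ) (hq : ∑ i, q i = 1) :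
    ∑ ω : Fin T → Fin K, ∏ t, q (ω t) = 1 := by
  have h := Finset.prod_univ_sum (fun _ : Fin T => (Finset.univ : Finset (Fin K)))
    (fun _ j => q j)
  rw [Fintype.piFinset_univ] at h
  rw [← h]
  simp [hq]

lemma aux_weight {K T : ℕ} (q : Fin K → ℝ) (t : Fin T) (ω : Fin T → Fin K) (i : Fin K) :
    (∏ s, q (Function.update ω t i s)) * q (ω t) = (∏ s, q (ω s)) * q i := by
  rw [← Finset.mul_prod_erase _ _ (Finset.mem_univ t),
    ← Finset.mul_prod_erase _ (fun s => q (ω s)) (Finset.mem_univ t)]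
  have : ∏ s ∈ Finset.univ.erase t, q (Function.update ω t i s)
      = ∏ s ∈ Finset.univ.erase t, q (ω s) := by
    apply Finset.prod_congr rfl
    intro s hs
    rw [Function.update_of_ne (Finset.ne_of_mem_erase hs)]
  rw [this]
  simp only [Function.update_self]
  ring

lemma aux_resample {K T : ℕ} (q : Fin K → ℝ) (hq : ∑ i, q i = 1) (t : Fin T)
    (G : (Fin T → Fin K) → ℝ) :
    ∑ ω : Fin T → Fin K, (∏ s, q (ω s)) * G ω =
      ∑ ω : Fin T → Fin K, (∏ s, q (ω s)) * ∑ i, q i * G (Function.update ω t i) := by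
  have h1 : ∑ ω : Fin T → Fin K, (∏ s, q (ω s)) * ∑ i, q i * G (Function.update ω t i)
      = ∑ p : (Fin T → Fin K) × Fin K,
        (∏ s, q (p.1 s)) * q p.2 * G (Function.update p.1 t p.2) := by
    rw [Fintype.sum_prod_type]
    simp only [Finset.mul_sum, mul_assoc]
  have h2 : ∑ ω : Fin T → Fin K, (∏ s, q (ω s)) * G ω
      = ∑ p : (Fin T → Fin K) × Fin K, (∏ s, q (p.1 s)) * q p.2 * G p.1 := by
    rw [Fintype.sum_prod_type]
    apply Finset.sum_congr rfl
    intro ω _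
    dsimp only
    rw [← Finset.sum_mul, ← Finset.mul_sum, hq, mul_one]
  rw [h1, h2]
  refine Finset.sum_nbij' (fun p => (Function.update p.1 t p.2, p.1 t))
    (fun p => (Function.update p.1 t p.2, p.1 t)) ?_ ?_ ?_ ?_ ?_
  · intros; simp
  · intros; simp
  · intros; simp
  · intros; simp
  · rintro ⟨ω, i⟩ _
    simp only [Function.update_idem, Function.update_eq_self, aux_weight]

lemma aux_W_nonneg {K T : ℕ} (q : Fin K → ℝ) (h0 : ∀ i, 0 ≤ q i) (ω : Fin T → Fin K) :
    0 ≤ ∏ s, q (ω s) := Finset.prod_nonneg fun _ _ => h0 _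

lemma aux_var {K T : ℕ} (q : Fin K → ℝ) (h0 : ∀ i, 0 ≤ q i) (hq : ∑ i, q i = 1)
    (i : Fin K) (S : Finset (Fin T)) :
    ∑ ω : Fin T → Fin K, (∏ s, q (ω s)) *
      (∑ τ ∈ S, ((if ω τ = i then (1 : ℝ) else 0) - q i)) ^ 2 ≤ S.card := by
  have hq1 : q i ≤ 1 := hq ▸ Finset.single_le_sum (fun j _ => h0 j) (Finset.mem_univ i)
  induction S using Finset.induction_on with
  | empty => simp
  | insert a S ha ih =>
    have hcross : ∑ ω : Fin T → Fin K, (∏ s, q (ω s)) *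
      (((if ω a = i then (1 : ℝ) else 0) - q i) *
        ∑ τ ∈ S, ((if ω τ = i then (1 : ℝ) else 0) - q i)) = 0 := by
      rw [aux_resample q hq a]
      apply Finset.sum_eq_zero
      intro ω _
      have : ∀ j, ∑ τ ∈ S, ((if Function.update ω a j τ = i then (1 : ℝ) else 0) - q i)
          = ∑ τ ∈ S, ((if ω τ = i then (1 : ℝ) else 0) - q i) := by
        intro j
        apply Finset.sum_congr rfl
        intro τ hτ
        rw [Function.update_of_ne (by rintro rfl; exact ha hτ)]
      simp only [this, Function.update_self, ← mul_assoc]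
      rw [← Finset.sum_mul]
      have h3 : ∑ j, q j * ((if j = i then (1 : ℝ) else 0) - q i) = 0 := by
        simp only [mul_sub, Finset.sum_sub_distrib, ← Finset.sum_mul, hq]
        simp
      rw [h3]; simp
    rw [Finset.card_insert_of_notMem ha]
    push_cast
    calc _ = ∑ ω : Fin T → Fin K, ((∏ s, q (ω s)) *
            (∑ τ ∈ S, ((if ω τ = i then (1 : ℝ) else 0) - q i)) ^ 2
          + 2 * ((∏ s, q (ω s)) * (((if ω a = i then (1 : ℝ) else 0) - q i) *
              ∑ τ ∈ S, ((if ω τ = i then (1 : ℝ) else 0) - q i)))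
          + (∏ s, q (ω s)) * ((if ω a = i then (1 : ℝ) else 0) - q i) ^ 2) := by
          apply Finset.sum_congr rfl
          intro ω _
          rw [Finset.sum_insert ha]; ring
      _ ≤ ∑ ω : Fin T → Fin K, ((∏ s, q (ω s)) *
            (∑ τ ∈ S, ((if ω τ = i then (1 : ℝ) else 0) - q i)) ^ 2
          + 2 * ((∏ s, q (ω s)) * (((if ω a = i then (1 : ℝ) else 0) - q i) *
              ∑ τ ∈ S, ((if ω τ = i then (1 : ℝ) else 0) - q i)))
          + (∏ s, q (ω s)) * 1) := by
          apply Finset.sum_le_sum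
          intro ω _
          have : ((if ω a = i then (1 : ℝ) else 0) - q i) ^ 2 ≤ 1 := by
            have := h0 i
            split_ifs <;> nlinarith
          have := mul_le_mul_of_nonneg_left this (aux_W_nonneg q h0 ω)
          linarith
      _ ≤ _ := by
          rw [Finset.sum_add_distrib, Finset.sum_add_distrib, ← Finset.mul_sum, hcross]
          simp only [mul_one, aux_mass q hq]
          linarith

lemma aux_card {T : ℕ} (t : Fin T) :
    (Finset.univ.filter (fun τ : Fin T => τ < t)).card = (t : ℕ) := by
  have : (Finset.univ.filter (fun τ : Fin T => τ < t)) = Finset.Iio t := by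
    ext; simp
  rw [this]; simp

lemma aux_dev {K T : ℕ} (hK : 1 ≤ K) (q : Fin K → ℝ) (h0 : ∀ i, 0 ≤ q i) (hq : ∑ i, q i = 1)
    (i : Fin K) (t : Fin T) :
    ∑ ω : Fin T → Fin K, (∏ s, q (ω s)) * |q i - empTypeDist K T t ω i|
      ≤ if (t : ℕ) = 0 then 1 else 1 / Real.sqrt (t : ℕ) := by
  have hq1 : q i ≤ 1 := hq ▸ Finset.single_le_sum (fun j _ => h0 j) (Finset.mem_univ i)
  have hK' : (1 : ℝ) ≤ K := by exact_mod_cast hK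
  split_ifs with ht
  · rw [← aux_mass (T := T) q hq]
    apply Finset.sum_le_sum
    intro ω _
    apply mul_le_of_le_one_right (aux_W_nonneg q h0 ω)
    simp only [empTypeDist, ht, if_true]
    have h1 : (0 : ℝ) ≤ 1 / K := by positivity
    have h2 : 1 / (K : ℝ) ≤ 1 := by rw [div_le_one (by linarith)]; exact hK'
    have := h0 i
    rw [abs_le]; constructor <;> linarith
  · have hv := aux_var q h0 hq i (Finset.univ.filter (fun τ : Fin T => τ < t))
    rw [aux_card] at hv
    have htp : (0 : ℝ) < (t : ℕ) := by exact_mod_cast Nat.pos_of_ne_zero ht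
    set n : ℝ := ((t : ℕ) : ℝ) with hn
    have hs : 0 < Real.sqrt n := Real.sqrt_pos.2 htp
    have hss : Real.sqrt n * Real.sqrt n = n := Real.mul_self_sqrt htp.le
    have key : ∀ ω : Fin T → Fin K, |q i - empTypeDist K T t ω i| ≤
        (1 / (2 * Real.sqrt n * n)) * (∑ τ ∈ Finset.univ.filter (fun τ : Fin T => τ < t),
          ((if ω τ = i then (1 : ℝ) else 0) - q i)) ^ 2 + 1 / (2 * Real.sqrt n) := by
      intro ω
      rw [Finset.sum_sub_distrib, Finset.sum_const, aux_card, nsmul_eq_mul]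
      simp only [empTypeDist, ht, if_false]
      rw [← hn]
      set A := ∑ τ ∈ Finset.univ.filter (fun τ : Fin T => τ < t),
          (if ω τ = i then (1 : ℝ) else 0)
      have e1 : q i - 1 / n * A = - ((A - n * q i) / n) := by field_simp; ring
      rw [e1, abs_neg, abs_div, abs_of_pos htp, ← sq_abs (A - n * q i)]
      set B := |A - n * q i|
      have e2 : 1 / (2 * Real.sqrt n * n) * B ^ 2 + 1 / (2 * Real.sqrt n) - B / n
          = (B - Real.sqrt n) ^ 2 / (2 * Real.sqrt n * n) := by
        field_simp
        nlinarith
      have : 0 ≤ (B - Real.sqrt n) ^ 2 / (2 * Real.sqrt n * n) := by positivity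
      linarith
    calc _ ≤ ∑ ω : Fin T → Fin K, ((1 / (2 * Real.sqrt n * n)) * ((∏ s, q (ω s)) *
          (∑ τ ∈ Finset.univ.filter (fun τ : Fin T => τ < t),
          ((if ω τ = i then (1 : ℝ) else 0) - q i)) ^ 2)
          + (∏ s, q (ω s)) * (1 / (2 * Real.sqrt n))) := by
          apply Finset.sum_le_sum
          intro ω _
          have := mul_le_mul_of_nonneg_left (key ω) (aux_W_nonneg q h0 ω)
          linarith
      _ ≤ (1 / (2 * Real.sqrt n * n)) * n + 1 / (2 * Real.sqrt n) := by
          rw [Finset.sum_add_distrib, ← Finset.mul_sum, ← Finset.sum_mul, aux_mass q hq, one_mul]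
          gcongr
      _ = _ := by field_simp; norm_num

lemma aux_sum (T : ℕ) :
    ∑ t ∈ Finset.range T, (if t = 0 then (1 : ℝ) else 1 / Real.sqrt t) ≤ 3 * Real.sqrt T := by
  induction T with
  | zero => simp
  | succ n ih =>
    rw [Finset.sum_range_succ]
    by_cases hn : n = 0
    · subst hn; norm_num
    · have hp : (1 : ℝ) ≤ n := by exact_mod_cast Nat.one_le_iff_ne_zero.2 hn
      simp only [hn, if_false]
      have ha : 0 < Real.sqrt n := Real.sqrt_pos.2 (by linarith)
      have haa : Real.sqrt n ^ 2 = n := Real.sq_sqrt (by linarith)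
      push_cast
      have hbb : Real.sqrt ((n : ℝ) + 1) ^ 2 = n + 1 := Real.sq_sqrt (by linarith)
      have hb : 0 ≤ Real.sqrt ((n : ℝ) + 1) := Real.sqrt_nonneg _
      set a := Real.sqrt n
      set c := Real.sqrt ((n : ℝ) + 1)
      have hc : c ≤ 2 * a := by nlinarith
      have hac : 1 / a ≤ 3 * (c - a) := by
        rw [div_le_iff₀ ha]
        nlinarith [mul_nonneg (sub_nonneg.2 hc) hb]
      linarith

lemma aux_collapse {K : ℕ} {Af : Type} [Fintype Af] [DecidableEq Af] (p : Fin K → ℝ)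
    (b : Fin K → Af) (u : Af → ℝ) :
    ∑ a, (∑ i, if b i = a then p i else 0) * u a = ∑ i, p i * u (b i) := by
  simp only [Finset.sum_mul]
  rw [Finset.sum_comm]
  apply Finset.sum_congr rfl
  intro i _
  simp [ite_mul]

/-- **Greedy with empirical type frequencies achieves `O(K √(T log T))` regret.**
There is an absolute constant `C` such that for every instance with `K ≥ 1` follower
types, horizon `T ≥ 2`, i.i.d. follower types `f_t = ω t` with distribution `q`
(under the product weight `∏ t, q (ω t)`), adaptively adversarial contexts `z t ω`
(depending only on coordinates `< t`), finite nonempty strategy sets `E z`, leader utility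
`u ∈ [0,1]`, estimates `p̂_t(z,x)(a) = Σ_i 1{b_i(z,x) = a}·p̂_t(i)` built from the
empirical type frequencies, and greedy play `π t ω` maximizing the estimated utility over
`E (z t ω)`: for every comparator policy `ρ` with `ρ z ∈ E z`, the expected regret of the
greedy leader against `ρ` is at most `C·K·√(T·log T)`. -/
theorem stmt6 :
    ∃ C : ℝ, 0 < C ∧
    ∀ (Z X Af : Type) [Fintype Af] [DecidableEq Af] (K T : ℕ), 1 ≤ K → 2 ≤ T →
    ∀ q : Fin K → ℝ, (∀ i, 0 ≤ q i) → (∑ i, q i = 1) →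
    ∀ b : Fin K → Z → X → Af,
    ∀ u : Z → X → Af → ℝ, (∀ z x a, u z x a ∈ Set.Icc (0 : ℝ) 1) →
    ∀ E : Z → Finset X, (∀ z, (E z).Nonempty) →
    ∀ z : Fin T → (Fin T → Fin K) → Z,
      (∀ t ω ω', (∀ s, s < t → ω s = ω' s) → z t ω = z t ω') →
    ∀ π : Fin T → (Fin T → Fin K) → X,
      (∀ t ω ω', (∀ s, s < t → ω s = ω' s) → π t ω = π t ω') →
      (∀ t ω, π t ω ∈ E (z t ω)) →
      (∀ t ω x, x ∈ E (z t ω) →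
        (∑ a, (∑ i, if b i (z t ω) x = a then empTypeDist K T t ω i else 0) *
            u (z t ω) x a) ≤
          ∑ a, (∑ i, if b i (z t ω) (π t ω) = a then empTypeDist K T t ω i else 0) *
            u (z t ω) (π t ω) a) →
    ∀ ρ : Z → X, (∀ zz, ρ zz ∈ E zz) →
    (∑ ω : Fin T → Fin K, (∏ t, q (ω t)) *
        (∑ t, (u (z t ω) (ρ (z t ω)) (b (ω t) (z t ω) (ρ (z t ω))) -
               u (z t ω) (π t ω) (b (ω t) (z t ω) (π t ω)))))
      ≤ C * K * Real.sqrt (T * Real.log T) := by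
  refine ⟨10, by norm_num, ?_⟩
  intro Z X Af _ _ K T hK hT q h0 hq b u hu E _ z hz π hπ hπE hgr ρ hρ
  have step : ∀ t : Fin T, ∑ ω : Fin T → Fin K, (∏ s, q (ω s)) *
      (u (z t ω) (ρ (z t ω)) (b (ω t) (z t ω) (ρ (z t ω))) -
               u (z t ω) (π t ω) (b (ω t) (z t ω) (π t ω))) ≤
      K * (if (t : ℕ) = 0 then (1 : ℝ) else 1 / Real.sqrt (t : ℕ)) := by
    intro t
    rw [aux_resample q hq t]
    have hzu : ∀ ω i, z t (Function.update ω t i) = z t ω := fun ω i =>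
      hz t _ _ fun s hs => Function.update_of_ne hs.ne _ _
    have hpu : ∀ ω i, π t (Function.update ω t i) = π t ω := fun ω i =>
      hπ t _ _ fun s hs => Function.update_of_ne hs.ne _ _
    simp only [hzu, hpu, Function.update_self]
    calc _ ≤ ∑ ω : Fin T → Fin K, (∏ s, q (ω s)) *
          ∑ i, |q i - empTypeDist K T t ω i| := by
          apply Finset.sum_le_sum
          intro ω _
          apply mul_le_mul_of_nonneg_left _ (aux_W_nonneg q h0 ω)
          have hg := hgr t ω (ρ (z t ω)) (hρ _)
          rw [aux_collapse _ (fun i => b i (z t ω) (ρ (z t ω))),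
            aux_collapse _ (fun i => b i (z t ω) (π t ω))] at hg
          have hle : ∑ i, (q i - empTypeDist K T t ω i) *
              (u (z t ω) (ρ (z t ω)) (b i (z t ω) (ρ (z t ω))) -
               u (z t ω) (π t ω) (b i (z t ω) (π t ω)))
              ≤ ∑ i, |q i - empTypeDist K T t ω i| := by
            apply Finset.sum_le_sum
            intro i _
            refine (le_abs_self _).trans ?_
            rw [abs_mul]
            apply mul_le_of_le_one_right (abs_nonneg _)
            have h1 := hu (z t ω) (ρ (z t ω)) (b i (z t ω) (ρ (z t ω)))
            have h2 := hu (z t ω) (π t ω) (b i (z t ω) (π t ω))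
            rw [abs_le]
            constructor <;> linarith [h1.1, h1.2, h2.1, h2.2]
          refine le_trans ?_ hle
          simp only [sub_mul, mul_sub, Finset.sum_sub_distrib]
          linarith
      _ = ∑ i, ∑ ω : Fin T → Fin K, (∏ s, q (ω s)) * |q i - empTypeDist K T t ω i| := by
          simp only [Finset.mul_sum]
          rw [Finset.sum_comm]
      _ ≤ ∑ i : Fin K, (if (t : ℕ) = 0 then (1 : ℝ) else 1 / Real.sqrt (t : ℕ)) :=
          Finset.sum_le_sum fun i _ => aux_dev hK q h0 hq i t
      _ = _ := by rw [Finset.sum_const, nsmul_eq_mul]; simp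
  simp only [Finset.mul_sum]
  rw [Finset.sum_comm]
  refine (Finset.sum_le_sum fun t _ => step t).trans ?_
  rw [← Finset.mul_sum, Fin.sum_univ_eq_sum_range
    (fun t => if t = 0 then (1 : ℝ) else 1 / Real.sqrt t) T]
  have hT' : (2 : ℝ) ≤ T := by exact_mod_cast hT
  have hlog : (1 / 4 : ℝ) ≤ Real.log T := by
    have := Real.log_le_log (by norm_num) hT'
    linarith [Real.log_two_gt_d9]
  have hs : Real.sqrt T ≤ 2 * Real.sqrt (T * Real.log T) := by
    rw [Real.sqrt_le_left (by positivity), mul_pow, Real.sq_sqrt (by nlinarith)]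
    nlinarith
  have hsum := aux_sum T
  have : (K : ℝ) * ∑ t ∈ Finset.range T, (if t = 0 then (1 : ℝ) else 1 / Real.sqrt t)
      ≤ K * (10 * Real.sqrt (T * Real.log T)) := by
    apply mul_le_mul_of_nonneg_left _ (Nat.cast_nonneg K)
    linarith [Real.sqrt_nonneg (T * Real.log T)]
  linarith
end

section
/- Let K ≥ 1 and T ≥ 1 be natural numbers and let Ω_T = {ω ∈ ℝ^K : ω_i ≥ 0, Σ_i ω_i = 1, T·ω_i ∈ ℕ for all i} (a finite nonempty set). Let S ⊆ [0,1]^K, and suppose that for each ω ∈ Ω_T there is an element u_ω ∈ S with ⟨u_ω, ω⟩ ≥ ⟨u, ω⟩ for all u ∈ S. Then for every v ∈ ℝ^K with v_i ≥ 0 and Σ_i v_i = T, and every u ∈ S: ⟨u, v⟩ ≤ max_{ω ∈ Ω_T} ⟨u_ω, v⟩ + 2K. -/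
/-- **Discretization over the grid `Ω_T` costs at most `2K`.**
Let `Ω_T = {ω ∈ Δ^K : T·ω_i ∈ ℕ for all i}` and let `S ⊆ [0,1]^K`.  Suppose that for each
`ω ∈ Ω_T` the element `usel ω ∈ S` maximizes `⟨·, ω⟩` over `S`.  Then for every
nonnegative `v ∈ ℝ^K` with `Σ_i v_i = T` and every `u ∈ S`, there is a grid point
`ω ∈ Ω_T` with `⟨u, v⟩ ≤ ⟨usel ω, v⟩ + 2K`; equivalently
`⟨u, v⟩ ≤ max_{ω ∈ Ω_T} ⟨u_ω, v⟩ + 2K`. -/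
theorem stmt11 (K T : ℕ) (hK : 1 ≤ K) (hT : 1 ≤ T)
    (S : Set (Fin K → ℝ)) (hS : ∀ u ∈ S, ∀ i, u i ∈ Set.Icc (0 : ℝ) 1)
    (usel : (Fin K → ℝ) → (Fin K → ℝ))
    (husel : ∀ ω : Fin K → ℝ,
      ((∀ i, 0 ≤ ω i) ∧ (∑ i, ω i = 1) ∧ (∀ i, ∃ n : ℕ, (T : ℝ) * ω i = n)) →
      usel ω ∈ S ∧ ∀ u ∈ S, (∑ i, u i * ω i) ≤ ∑ i, usel ω i * ω i)
    (v : Fin K → ℝ) (hv0 : ∀ i, 0 ≤ v i) (hv1 : ∑ i, v i = T)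
    (u : Fin K → ℝ) (hu : u ∈ S) :
    ∃ ω : Fin K → ℝ,
      ((∀ i, 0 ≤ ω i) ∧ (∑ i, ω i = 1) ∧ (∀ i, ∃ n : ℕ, (T : ℝ) * ω i = n)) ∧
      (∑ i, u i * v i) ≤ (∑ i, usel ω i * v i) + 2 * K := by
  have hT' : (0 : ℝ) < T := by exact_mod_cast hT
  let i0 : Fin K := ⟨0, hK⟩
  set m : Fin K → ℕ := fun i => ⌊v i⌋₊ with hm
  have hm1 : ∀ i, (m i : ℝ) ≤ v i := fun i => Nat.floor_le (hv0 i)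
  have hm2 : ∀ i, v i ≤ m i + 1 := fun i => (Nat.lt_floor_add_one (v i)).le
  have hMr : (∑ i, (m i : ℝ)) ≤ T := hv1 ▸ Finset.sum_le_sum (fun i _ => hm1 i)
  have hM : ∑ i, m i ≤ T := by exact_mod_cast hMr
  obtain ⟨r, hr⟩ := Nat.exists_eq_add_of_le hM
  have hr' : (T : ℝ) = ∑ i, (m i : ℝ) + r := by exact_mod_cast hr
  have hrK : (r : ℝ) ≤ K := by
    have h : ∑ i, v i ≤ ∑ i, ((m i : ℝ) + 1) := Finset.sum_le_sum (fun i _ => hm2 i)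
    rw [Finset.sum_add_distrib, hv1] at h
    simp at h
    linarith
  set e : Fin K → ℕ := fun i => if i = i0 then r else 0 with he
  have hes : ∑ i, (e i : ℝ) = r := by simp [he]
  set ω : Fin K → ℝ := fun i => ((m i : ℝ) + e i) / T with hω
  have hTω : ∀ i, (T : ℝ) * ω i = m i + e i := fun i => by
    simp only [hω]; field_simp
  have hgrid : (∀ i, 0 ≤ ω i) ∧ (∑ i, ω i = 1) ∧ (∀ i, ∃ n : ℕ, (T : ℝ) * ω i = n) := by
    refine ⟨fun i => by simp only [hω]; positivity, ?_, fun i => ⟨m i + e i, ?_⟩⟩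
    · simp only [hω]
      rw [← Finset.sum_div, Finset.sum_add_distrib, hes, ← hr', div_self hT'.ne']
    · rw [hTω]; push_cast; rfl
  refine ⟨ω, hgrid, ?_⟩
  obtain ⟨hw, hopt⟩ := husel ω hgrid
  have h1 := mul_le_mul_of_nonneg_left (hopt u hu) hT'.le
  rw [Finset.mul_sum, Finset.mul_sum] at h1
  have h2 : ∀ i, u i * v i - usel ω i * v i ≤
      (T * (u i * ω i) - T * (usel ω i * ω i)) + ((v i - m i) + e i) := by
    intro i
    have a := hS u hu i
    have b := hS _ hw i
    obtain ⟨a0, a1⟩ := a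
    obtain ⟨b0, b1⟩ := b
    have e0 : (0 : ℝ) ≤ e i := Nat.cast_nonneg _
    have f0 := hm1 i
    have k : (T * (u i * ω i) - T * (usel ω i * ω i)) = (u i - usel ω i) * (m i + e i) := by
      rw [← hTω]; ring
    rw [k]
    have p1 : 0 ≤ (1 - (u i - usel ω i)) * (v i - m i) :=
      mul_nonneg (by linarith) (by linarith)
    have p2 : 0 ≤ (1 + (u i - usel ω i)) * (e i : ℝ) :=
      mul_nonneg (by linarith) e0
    nlinarith
  have h3 := Finset.sum_le_sum (fun i (_ : i ∈ Finset.univ) => h2 i)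
  simp only [Finset.sum_add_distrib, Finset.sum_sub_distrib] at h3
  rw [hes, hv1] at h3
  linarith
end

section
/- Discretization theorem for stochastic contexts and adaptive follower adversaries: Let Z_1, …, Z_T be i.i.d. with law μ on Z, and let f_t = φ_t(Z_1, …, Z_{t−1}) ∈ {1, …, K} for fixed measurable functions φ_t. For each z let E_z ⊆ X be finite and nonempty, and for each ω in the grid Ω_T = {ω ∈ Δ^K : T·ω_i ∈ ℕ} define a policy π^(ω) by π^(ω)(z) ∈ argmax_{x ∈ E_z} Σ_{i=1}^K ω_i·u(z, x, b_i(z, x)) (any measurable selection). Then for every policy π̄ with π̄(z) ∈ E_z for all z (and all relevant maps measurable): E[Σ_{t=1}^T u(Z_t, π̄(Z_t), b_{f_t}(Z_t, π̄(Z_t)))] ≤ max_{ω ∈ Ω_T} E[Σ_{t=1}^T u(Z_t, π^(ω)(Z_t), b_{f_t}(Z_t, π^(ω)(Z_t)))] + 2K. -/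
open MeasureTheory Finset

theorem aux_indep {Z : Type*} [MeasurableSpace Z]
    (μ : Measure Z) [IsProbabilityMeasure μ] (T K : ℕ)
    (φ : Fin T → (Fin T → Z) → Fin K)
    (hφ_meas : ∀ t, Measurable (φ t))
    (hφ_past : ∀ t ω ω', (∀ s, s < t → ω s = ω' s) → φ t ω = φ t ω') (t : Fin T) :
    ProbabilityTheory.IndepFun (φ t) (fun ω => ω t) (Measure.pi fun _ : Fin T => μ) := by
  classical
  obtain ⟨z0⟩ : Nonempty Z := μ.nonempty_of_neZero
  have h1 : ProbabilityTheory.iIndepFun (fun (i : Fin T) (ω : Fin T → Z) => ω i)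
      (Measure.pi fun _ : Fin T => μ) :=
    ProbabilityTheory.iIndepFun_pi (X := fun _ z => z) (fun i => aemeasurable_id)
  have h2 := h1.indepFun_finset (Finset.univ.filter (· < t)) {t} (by simp)
    (fun i => measurable_pi_apply i)
  let ext : ((Finset.univ.filter (· < t) : Finset (Fin T)) → Z) → (Fin T → Z) :=
    fun y s => if h : s ∈ Finset.univ.filter (· < t) then y ⟨s, h⟩ else z0
  have hext : Measurable ext := by
    refine measurable_pi_lambda _ (fun s => ?_)
    by_cases h : s ∈ Finset.univ.filter (· < t)
    · simp only [ext, dif_pos h]; exact measurable_pi_apply _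
    · simp only [ext, dif_neg h]; exact measurable_const
  have hev : Measurable (fun y : (({t} : Finset (Fin T)) → Z) => y ⟨t, by simp⟩) :=
    measurable_pi_apply _
  have h3 := h2.comp (φ := fun y => φ t (ext y))
    ((hφ_meas t).comp hext) hev
  have h4 : φ t = (fun y => φ t (ext y)) ∘ fun a i => a i.1 := by
    funext ω
    refine hφ_past t _ _ (fun s hs => ?_)
    simp [ext, hs]
  rw [h4]
  exact h3

theorem aux_value {Z : Type*} [MeasurableSpace Z]
    (μ : Measure Z) [IsProbabilityMeasure μ] (T K : ℕ)
    (φ : Fin T → (Fin T → Z) → Fin K)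
    (hφ_meas : ∀ t, Measurable (φ t))
    (hφ_past : ∀ t ω ω', (∀ s, s < t → ω s = ω' s) → φ t ω = φ t ω')
    (g : Fin K → Z → ℝ) (hg : ∀ i, Measurable (g i)) (hg01 : ∀ i z, g i z ∈ Set.Icc (0:ℝ) 1) :
    ∫ ω, (∑ t, g (φ t ω) (ω t)) ∂(Measure.pi fun _ : Fin T => μ)
      = ∑ i, (∑ t, ∫ ω, (if φ t ω = i then (1:ℝ) else 0) ∂(Measure.pi fun _ : Fin T => μ))
        * ∫ z, g i z ∂μ := by
  have hm : ∀ i : Fin K, Measurable (fun j : Fin K => if j = i then (1:ℝ) else 0) :=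
    fun i => measurable_of_finite _
  have hI : ∀ t i, Integrable (fun ω : Fin T → Z => (if φ t ω = i then (1:ℝ) else 0) * g i (ω t))
      (Measure.pi fun _ : Fin T => μ) := by
    intro t i
    refine Integrable.of_bound (C := 1) ?_ ?_
    · exact (((hm i).comp (hφ_meas t)).mul
        ((hg i).comp (measurable_pi_apply t))).aestronglyMeasurable
    · refine Filter.Eventually.of_forall (fun ω => ?_)
      have := hg01 i (ω t)
      split_ifs
      · simpa [abs_of_nonneg this.1] using this.2
      · simp
  have hsum : ∀ ω : Fin T → Z, (∑ t, g (φ t ω) (ω t))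
      = ∑ t, ∑ i, (if φ t ω = i then (1:ℝ) else 0) * g i (ω t) := by
    intro ω; simp
  simp_rw [hsum]
  rw [integral_finsetSum _ (fun t _ => integrable_finsetSum _ (fun i _ => hI t i))]
  simp_rw [Finset.sum_mul]
  rw [Finset.sum_comm]
  refine Finset.sum_congr rfl (fun t _ => ?_)
  rw [integral_finsetSum _ (fun i _ => hI t i)]
  refine Finset.sum_congr rfl (fun i _ => ?_)
  have h := (aux_indep μ T K φ hφ_meas hφ_past t).integral_fun_comp_mul_comp
    (f := fun j => if j = i then (1:ℝ) else 0) (g := g i)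
    (hφ_meas t).aemeasurable (measurable_pi_apply t).aemeasurable
    (hm i).aestronglyMeasurable (hg i).aestronglyMeasurable
  rw [h]
  congr 1
  exact MeasureTheory.integral_comp_eval (μ := fun _ : Fin T => μ) (i := t)
    (hg i).aestronglyMeasurable

theorem aux_round (T K : ℕ) (hK : 1 ≤ K) (p : Fin K → ℝ) (hp : ∀ i, 0 ≤ p i)
    (hs : ∑ i, p i = T) :
    ∃ n : Fin K → ℕ, ∑ i, n i = T ∧ ∑ i, |p i - n i| ≤ 2 * K := by
  let i0 : Fin K := ⟨0, hK⟩
  have hle : ∑ i, ⌊p i⌋₊ ≤ T := by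
    have : ((∑ i, ⌊p i⌋₊ : ℕ) : ℝ) ≤ T := by
      rw [← hs]; push_cast
      exact Finset.sum_le_sum (fun i _ => Nat.floor_le (hp i))
    exact_mod_cast this
  obtain ⟨r, hr⟩ := Nat.exists_eq_add_of_le hle
  have hfr : ∑ i, (p i - ⌊p i⌋₊) = r := by
    rw [Finset.sum_sub_distrib, hs, hr]; push_cast; ring
  have hfK : ∑ i, (p i - ⌊p i⌋₊) ≤ K := by
    calc _ ≤ ∑ i : Fin K, (1:ℝ) :=
          Finset.sum_le_sum (fun i _ => by linarith [Nat.lt_floor_add_one (p i)])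
      _ = K := by simp
  refine ⟨fun i => ⌊p i⌋₊ + if i = i0 then r else 0, ?_, ?_⟩
  · rw [Finset.sum_add_distrib, hr]; simp
  · calc _ ≤ ∑ i, ((p i - ⌊p i⌋₊) + if i = i0 then (r:ℝ) else 0) := by
          refine Finset.sum_le_sum (fun i _ => ?_)
          have h1 := Nat.floor_le (hp i)
          have h2 : (0:ℝ) ≤ if i = i0 then (r:ℝ) else 0 := by split_ifs <;> positivity
          push_cast
          rw [abs_le]; constructor <;> linarith
      _ = r + r := by rw [Finset.sum_add_distrib, hfr]; simp
      _ ≤ 2 * K := by linarith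

/-- **Discretization theorem for stochastic contexts and adaptive follower adversaries.**
Let `Z_1, …, Z_T` be i.i.d. with law `μ` (coordinates of `ω : Fin T → Z` under the product
measure), and let the adversary's types `f_t = φ t ω ∈ {1,…,K}` be measurable functions of
the coordinates `ω s`, `s < t` only.  For each context `z` let `E z ⊆ X` be finite and
nonempty, and for each grid point `w ∈ Ω_T = {w ∈ Δ^K : T·w_i ∈ ℕ}` let `πsel w` be a
policy with `πsel w z ∈ argmax_{x ∈ E z} Σ_i w_i · u(z, x, b_i(z, x))`.  Then for every
policy `πbar` with `πbar z ∈ E z` for all `z` (all relevant maps being measurable), there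
is a grid point `w ∈ Ω_T` with
`E[Σ_t u(Z_t, πbar(Z_t), b_{f_t}(Z_t, πbar(Z_t)))]
   ≤ E[Σ_t u(Z_t, πsel w (Z_t), b_{f_t}(Z_t, πsel w (Z_t)))] + 2K`,
i.e. the expected utility of `πbar` is at most `max_{w ∈ Ω_T}` of the expected utility of
`π^(w)` plus `2K`. -/
theorem stmt12 {Z X Af : Type*} [MeasurableSpace Z] [Fintype Af]
    (μ : Measure Z) [IsProbabilityMeasure μ]
    (T K : ℕ) (hT : 1 ≤ T) (hK : 1 ≤ K)
    (φ : Fin T → (Fin T → Z) → Fin K)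
    (hφ_meas : ∀ t, Measurable (φ t))
    (hφ_past : ∀ t ω ω', (∀ s, s < t → ω s = ω' s) → φ t ω = φ t ω')
    (b : Fin K → Z → X → Af)
    (u : Z → X → Af → ℝ) (hu : ∀ z x a, u z x a ∈ Set.Icc (0 : ℝ) 1)
    (E : Z → Finset X) (hE : ∀ z, (E z).Nonempty)
    (πsel : (Fin K → ℝ) → Z → X)
    (hπsel : ∀ w : Fin K → ℝ,
      ((∀ i, 0 ≤ w i) ∧ (∑ i, w i = 1) ∧ (∀ i, ∃ n : ℕ, (T : ℝ) * w i = n)) →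
      ∀ z, πsel w z ∈ E z ∧
        ∀ x ∈ E z, (∑ i, w i * u z x (b i z x)) ≤
          ∑ i, w i * u z (πsel w z) (b i z (πsel w z)))
    (hπsel_meas : ∀ w i, Measurable fun z => u z (πsel w z) (b i z (πsel w z)))
    (πbar : Z → X) (hπbar : ∀ z, πbar z ∈ E z)
    (hπbar_meas : ∀ i, Measurable fun z => u z (πbar z) (b i z (πbar z))) :
    ∃ w : Fin K → ℝ,
      ((∀ i, 0 ≤ w i) ∧ (∑ i, w i = 1) ∧ (∀ i, ∃ n : ℕ, (T : ℝ) * w i = n)) ∧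
      (∫ ω, (∑ t, u (ω t) (πbar (ω t)) (b (φ t ω) (ω t) (πbar (ω t))))
          ∂(Measure.pi fun _ : Fin T => μ))
        ≤ (∫ ω, (∑ t, u (ω t) (πsel w (ω t)) (b (φ t ω) (ω t) (πsel w (ω t))))
            ∂(Measure.pi fun _ : Fin T => μ)) + 2 * K := by
  classical
  set P := Measure.pi fun _ : Fin T => μ with hP
  have hTpos : (0:ℝ) < T := by exact_mod_cast hT
  let p : Fin K → ℝ := fun i => ∑ t, ∫ ω, (if φ t ω = i then (1:ℝ) else 0) ∂P
  have hp : ∀ i, 0 ≤ p i := fun i => Finset.sum_nonneg (fun t _ =>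
    integral_nonneg (fun ω => by dsimp only; split_ifs <;> norm_num))
  have hs : ∑ i, p i = T := by
    have := aux_value μ T K φ hφ_meas hφ_past (fun _ _ => 1) (fun _ => measurable_const)
      (fun _ _ => by simp)
    simp at this
    exact this.symm
  obtain ⟨n, hn, hnK⟩ := aux_round T K hK p hp hs
  have hw : (∀ i, 0 ≤ (n i : ℝ) / T) ∧ (∑ i, (n i : ℝ) / T = 1) ∧
      (∀ i, ∃ m : ℕ, (T : ℝ) * ((n i : ℝ) / T) = m) := by
    refine ⟨fun i => by positivity, ?_, fun i => ⟨n i, by field_simp⟩⟩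
    rw [← Finset.sum_div, div_eq_one_iff_eq hTpos.ne']
    exact_mod_cast hn
  refine ⟨fun i => (n i : ℝ) / T, hw, ?_⟩
  have hsel := hπsel _ hw
  have hselm := hπsel_meas (fun i => (n i : ℝ) / T)
  generalize πsel (fun i => (n i : ℝ) / T) = π at hsel hselm ⊢
  have e1 := aux_value μ T K φ hφ_meas hφ_past _ hπbar_meas (fun _ _ => hu _ _ _)
  have e2 := aux_value μ T K φ hφ_meas hφ_past _ hselm (fun _ _ => hu _ _ _)
  rw [e1, e2]
  have int1 : ∀ (q : Z → X) (i), Measurable (fun z => u z (q z) (b i z (q z))) →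
      Integrable (fun z => u z (q z) (b i z (q z))) μ := fun q i h =>
    Integrable.of_bound (C := 1) h.aestronglyMeasurable (Filter.Eventually.of_forall (fun z => by
      rw [Real.norm_eq_abs, abs_of_nonneg (hu _ _ _).1]; exact (hu _ _ _).2))
  have b01 : ∀ (q : Z → X) (i), Measurable (fun z => u z (q z) (b i z (q z))) →
      0 ≤ ∫ z, u z (q z) (b i z (q z)) ∂μ ∧ ∫ z, u z (q z) (b i z (q z)) ∂μ ≤ 1 := by
    intro q i h
    refine ⟨integral_nonneg (fun z => (hu _ _ _).1), ?_⟩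
    calc _ ≤ ∫ z, (1:ℝ) ∂μ := integral_mono (int1 q i h) (integrable_const _)
            (fun z => (hu _ _ _).2)
      _ = 1 := by simp
  have key : ∑ i, (n i : ℝ) * ∫ z, u z (πbar z) (b i z (πbar z)) ∂μ ≤
      ∑ i, (n i : ℝ) * ∫ z, u z (π z) (b i z (π z)) ∂μ := by
    simp_rw [← integral_const_mul]
    rw [← integral_finsetSum _ (fun i _ => (int1 _ i (hπbar_meas i)).const_mul _),
      ← integral_finsetSum _ (fun i _ => (int1 _ i (hselm i)).const_mul _)]
    refine integral_mono (integrable_finsetSum _ (fun i _ => (int1 _ i (hπbar_meas i)).const_mul _))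
      (integrable_finsetSum _ (fun i _ => (int1 _ i (hselm i)).const_mul _)) (fun z => ?_)
    have h := (hsel z).2 _ (hπbar z)
    simp_rw [div_mul_eq_mul_div] at h
    rw [← Finset.sum_div, ← Finset.sum_div] at h
    exact (div_le_div_iff_of_pos_right hTpos).1 h
  have hB := fun i => b01 πbar i (hπbar_meas i)
  have hS := fun i => b01 π i (hselm i)
  change ∑ i, p i * _ ≤ ∑ i, p i * _ + _
  have fin : ∑ i, (p i - n i) * (∫ z, u z (πbar z) (b i z (πbar z)) ∂μ
      - ∫ z, u z (π z) (b i z (π z)) ∂μ) ≤ 2 * K := by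
    refine le_trans (Finset.sum_le_sum (fun i _ => ?_)) hnK
    refine le_trans (le_abs_self _) ?_
    rw [abs_mul]
    refine mul_le_of_le_one_right (abs_nonneg _) ?_
    rw [abs_le]
    constructor <;> linarith [(hB i).1, (hB i).2, (hS i).1, (hS i).2]
  simp only [sub_mul, mul_sub, Finset.sum_sub_distrib] at fin
  linarith
end

section
/- Lemma (unbiasedness and boundedness of the block estimator): Fix a block length B ≥ 1, a finite follower action set A_f, and K follower types with context-independent best-response functions b_i : X → A_f. Fix follower types f_1, …, f_B ∈ {1, …, K} (a non-adaptive adversary). For x ∈ X and a ∈ A_f let w(x, a) ∈ {0,1}^K be the vector with w(x, a)_i = 1{b_i(x) = a}, and for w ∈ ℝ^K let p_B(w) = (1/B)·Σ_{b=1}^B w_{f_b}. Suppose there are pairs (x^{(1)}, a^{(1)}), …, (x^{(K)}, a^{(K)}) ∈ X × A_f and coefficients λ_j(x, a) ∈ [−1, 1] such that w(x, a) = Σ_{j=1}^K λ_j(x, a)·w(x^{(j)}, a^{(j)}) for all (x, a) considered (a barycentric spanner representation). Let Z_1, …, Z_B be i.i.d. with law μ on a context space Z, let τ and t_1, …, t_K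 be uniform on {1, …, B}, all mutually independent and independent of (Z_b), and set p̂_j = 1{b_{f_{t_j}}(x^{(j)}) = a^{(j)}}. For a policy π : Z → X define û(π) = Σ_{a ∈ A_f} u(Z_τ, π(Z_τ), a)·Σ_{j=1}^K λ_j(π(Z_τ), a)·p̂_j, where u : Z × X × A_f → [0,1] is the leader utility. Then (i) E[û(π)] = E_{Z∼μ}[Σ_{a ∈ A_f} u(Z, π(Z), a)·p_B(w(π(Z), a))], and (ii) |û(π)| ≤ K·|A_f| almost surely. -/
open MeasureTheory Finset


theorem aux_unif_prob (B : ℕ) (hB : 1 ≤ B) :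
    IsProbabilityMeasure ((B : ENNReal)⁻¹ • (Measure.count : Measure (Fin B))) := by
  constructor
  simp only [Measure.smul_apply, Measure.count_univ, smul_eq_mul]
  rw [ENat.card_eq_coe_fintype_card]
  simp only [Fintype.card_fin]
  apply ENNReal.inv_mul_cancel
  · simp; omega
  · simp

theorem aux_term {Z : Type*} [MeasurableSpace Z] (μ : Measure Z) [IsProbabilityMeasure μ]
    {B K : ℕ} (ν : Measure (Fin B)) [IsProbabilityMeasure ν]
    (g : Z → ℝ) (hg : Measurable g) (hb : ∀ z, |g z| ≤ 1) (h : Fin B → ℝ) (j : Fin K) :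
    Integrable (fun x : (Fin B → Z) × (Fin B × (Fin K → Fin B)) => g (x.1 x.2.1) * h (x.2.2 j))
      ((Measure.pi fun _ : Fin B => μ).prod (ν.prod (Measure.pi fun _ : Fin K => ν))) ∧
    ∫ x : (Fin B → Z) × (Fin B × (Fin K → Fin B)), g (x.1 x.2.1) * h (x.2.2 j)
      ∂((Measure.pi fun _ : Fin B => μ).prod (ν.prod (Measure.pi fun _ : Fin K => ν)))
      = (∫ z, g z ∂μ) * ∫ t, h t ∂ν := by
  have e : (fun x : (Fin B → Z) × (Fin B × (Fin K → Fin B)) => g (x.1 x.2.1) * h (x.2.2 j))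
      = fun x => ∑ s : Fin B, g (x.1 s) * ((if x.2.1 = s then (1:ℝ) else 0) * h (x.2.2 j)) := by
    funext x
    simp
  have hgi : Integrable g μ := Integrable.of_bound hg.aestronglyMeasurable 1
    (Filter.Eventually.of_forall hb)
  have hi : ∀ s : Fin B, Integrable (fun x : (Fin B → Z) × (Fin B × (Fin K → Fin B)) =>
      g (x.1 s) * ((if x.2.1 = s then (1:ℝ) else 0) * h (x.2.2 j)))
      ((Measure.pi fun _ : Fin B => μ).prod (ν.prod (Measure.pi fun _ : Fin K => ν))) := by
    intro s
    have h1 : Integrable (fun z : Fin B → Z => g (z s)) (Measure.pi fun _ : Fin B => μ) :=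
      (measurePreserving_eval (fun _ : Fin B => μ) s).integrable_comp_of_integrable hgi
    have h2 : Integrable (fun t : Fin K → Fin B => h (t j)) (Measure.pi fun _ : Fin K => ν) :=
      (measurePreserving_eval (fun _ : Fin K => ν) j).integrable_comp_of_integrable
        (Integrable.of_finite)
    have h3 : Integrable (fun t : Fin B => if t = s then (1:ℝ) else 0) ν := Integrable.of_finite
    exact h1.mul_prod (h3.mul_prod h2)
  rw [e]
  refine ⟨integrable_finsetSum _ fun s _ => hi s, ?_⟩
  rw [integral_finsetSum _ fun s _ => hi s]
  have ht : ∀ s : Fin B, ∫ x : (Fin B → Z) × (Fin B × (Fin K → Fin B)),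
      g (x.1 s) * ((if x.2.1 = s then (1:ℝ) else 0) * h (x.2.2 j))
      ∂((Measure.pi fun _ : Fin B => μ).prod (ν.prod (Measure.pi fun _ : Fin K => ν)))
      = (∫ z, g z ∂μ) * ((∫ r, (if r = s then (1:ℝ) else 0) ∂ν) * ∫ t, h t ∂ν) := by
    intro s
    rw [integral_prod_mul (fun z : Fin B → Z => g (z s))
      (fun y : Fin B × (Fin K → Fin B) => (if y.1 = s then (1:ℝ) else 0) * h (y.2 j)),
      integral_prod_mul (fun r : Fin B => if r = s then (1:ℝ) else 0)
      (fun t : Fin K → Fin B => h (t j)),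
      integral_comp_eval (μ := fun _ : Fin B => μ) (f := g) (i := s) hg.aestronglyMeasurable,
      integral_comp_eval (μ := fun _ : Fin K => ν) (f := h) (i := j)
        (Measurable.of_discrete).aestronglyMeasurable]
  simp only [ht]
  rw [← Finset.mul_sum, ← Finset.sum_mul, ← integral_finsetSum _ fun s _ => Integrable.of_finite]
  simp

/-- **Unbiasedness and boundedness of the per-block utility estimator.**
Fix a block length `B ≥ 1`, a finite follower action set `Af`, `K` follower types with
context-independent best responses `b i : X → Af`, and fixed follower types
`f : Fin B → Fin K` (a non-adaptive adversary).  For `x ∈ X`, `a ∈ Af`, the best-response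
indicator vector is `w(x,a)_i = 1{b_i(x) = a}`, and for `w ∈ ℝ^K` the block frequency is
`p_B(w) = (1/B)·Σ_b w_{f_b}`.  Suppose there are spanner pairs `(xs j, as j)` and
coefficients `lam x a j ∈ [−1,1]` with `w(x,a) = Σ_j lam x a j · w(xs j, as j)` for all
`(x, a)` considered (i.e. `x = π z`).  Let `Z_1, …, Z_B` be i.i.d. with law `μ`, let `τ`
and `t_1, …, t_K` be uniform on `{1,…,B}`, all mutually independent (realized as the
product measure on `(Fin B → Z) × (Fin B × (Fin K → Fin B))`, where the uniform measure on
`Fin B` is `B⁻¹ • Measure.count`), and set `p̂_j = 1{b_{f_{t_j}}(xs j) = as j}`.  For a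
policy `π : Z → X` define
`û(π) = Σ_a u(Z_τ, π(Z_τ), a) · Σ_j lam (π(Z_τ)) a j · p̂_j`.  Then
(i) `E[û(π)] = E_{Z∼μ}[Σ_a u(Z, π(Z), a) · p_B(w(π(Z), a))]`, and
(ii) `|û(π)| ≤ K·|Af|` almost surely. -/
theorem stmt16 {Z X Af : Type*} [MeasurableSpace Z] [Fintype Af] [DecidableEq Af]
    (μ : Measure Z) [IsProbabilityMeasure μ]
    (B K : ℕ) (hB : 1 ≤ B) (hK : 1 ≤ K)
    (f : Fin B → Fin K)
    (b : Fin K → X → Af)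
    (u : Z → X → Af → ℝ) (hu : ∀ z x a, u z x a ∈ Set.Icc (0 : ℝ) 1)
    (xs : Fin K → X) (as : Fin K → Af)
    (lam : X → Af → Fin K → ℝ) (hlam : ∀ x a j, lam x a j ∈ Set.Icc (-1 : ℝ) 1)
    (π : Z → X)
    (hspan : ∀ z a (i : Fin K),
      (if b i (π z) = a then (1 : ℝ) else 0) =
        ∑ j, lam (π z) a j * (if b i (xs j) = as j then (1 : ℝ) else 0))
    (hmeas_u : ∀ a, Measurable fun z => u z (π z) a)
    (hmeas_lam : ∀ a j, Measurable fun z => lam (π z) a j) :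
    (∫ x : (Fin B → Z) × (Fin B × (Fin K → Fin B)),
        (∑ a, u (x.1 x.2.1) (π (x.1 x.2.1)) a *
          ∑ j, lam (π (x.1 x.2.1)) a j *
            (if b (f (x.2.2 j)) (xs j) = as j then (1 : ℝ) else 0))
        ∂((Measure.pi fun _ : Fin B => μ).prod
            (((B : ENNReal)⁻¹ • Measure.count).prod
              (Measure.pi fun _ : Fin K => (B : ENNReal)⁻¹ • Measure.count))))
      = (∫ z, (∑ a, u z (π z) a *
          ((1 / (B : ℝ)) * ∑ t : Fin B, (if b (f t) (π z) = a then (1 : ℝ) else 0))) ∂μ) ∧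
    (∀ᵐ x : (Fin B → Z) × (Fin B × (Fin K → Fin B))
        ∂((Measure.pi fun _ : Fin B => μ).prod
            (((B : ENNReal)⁻¹ • Measure.count).prod
              (Measure.pi fun _ : Fin K => (B : ENNReal)⁻¹ • Measure.count))),
      |∑ a, u (x.1 x.2.1) (π (x.1 x.2.1)) a *
          ∑ j, lam (π (x.1 x.2.1)) a j *
            (if b (f (x.2.2 j)) (xs j) = as j then (1 : ℝ) else 0)|
        ≤ (K : ℝ) * Fintype.card Af) := by
  have := aux_unif_prob B hB
  constructor
  · have e1 : ∀ x : (Fin B → Z) × (Fin B × (Fin K → Fin B)),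
        (∑ a, u (x.1 x.2.1) (π (x.1 x.2.1)) a *
          ∑ j, lam (π (x.1 x.2.1)) a j *
            (if b (f (x.2.2 j)) (xs j) = as j then (1 : ℝ) else 0))
        = ∑ a, ∑ j, (fun z => u z (π z) a * lam (π z) a j) (x.1 x.2.1) *
            (fun t => if b (f t) (xs j) = as j then (1 : ℝ) else 0) (x.2.2 j) := by
      intro x
      simp only [Finset.mul_sum, mul_assoc]
    have e2 : ∀ z, (∑ a, u z (π z) a *
          ((1 / (B : ℝ)) * ∑ t : Fin B, (if b (f t) (π z) = a then (1 : ℝ) else 0)))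
        = ∑ a, ∑ j, (u z (π z) a * lam (π z) a j) *
          ((1 / (B : ℝ)) * ∑ t : Fin B, (if b (f t) (xs j) = as j then (1 : ℝ) else 0)) := by
      intro z
      refine Finset.sum_congr rfl fun a _ => ?_
      simp only [hspan z a]
      rw [Finset.sum_comm]
      simp only [Finset.mul_sum]
      refine Finset.sum_congr rfl fun j _ => Finset.sum_congr rfl fun t _ => ?_
      ring
    have hm : ∀ a j, Measurable fun z => u z (π z) a * lam (π z) a j :=
      fun a j => (hmeas_u a).mul (hmeas_lam a j)
    have hbd : ∀ a j z, |u z (π z) a * lam (π z) a j| ≤ 1 := by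
      intro a j z
      rw [abs_mul]
      have h1 := hu z (π z) a
      have h2 := hlam (π z) a j
      exact mul_le_one₀ (abs_le.2 ⟨by linarith [h1.1], h1.2⟩) (abs_nonneg _) (abs_le.2 h2)
    have hgi : ∀ a j, Integrable (fun z => u z (π z) a * lam (π z) a j) μ := fun a j =>
      Integrable.of_bound (hm a j).aestronglyMeasurable 1 (Filter.Eventually.of_forall (hbd a j))
    have T := fun a (j : Fin K) => aux_term μ ((B : ENNReal)⁻¹ • (Measure.count : Measure (Fin B)))
      (fun z => u z (π z) a * lam (π z) a j) (hm a j) (hbd a j)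
      (fun t => if b (f t) (xs j) = as j then (1 : ℝ) else 0) j
    rw [integral_congr_ae (Filter.Eventually.of_forall e1),
      integral_congr_ae (Filter.Eventually.of_forall e2),
      integral_finsetSum _ fun a _ => integrable_finsetSum _ fun j _ => (T a j).1,
      integral_finsetSum _ fun a _ => integrable_finsetSum _ fun j _ => (hgi a j).mul_const _]
    refine Finset.sum_congr rfl fun a _ => ?_
    rw [integral_finsetSum _ fun j _ => (T a j).1,
      integral_finsetSum _ fun j _ => (hgi a j).mul_const _]
    refine Finset.sum_congr rfl fun j _ => ?_
    rw [(T a j).2, integral_mul_const, integral_smul_measure, integral_count]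
    simp
  · refine Filter.Eventually.of_forall fun x => ?_
    refine (Finset.abs_sum_le_sum_abs _ _).trans ?_
    have : ∀ a ∈ (Finset.univ : Finset Af), |u (x.1 x.2.1) (π (x.1 x.2.1)) a *
          ∑ j, lam (π (x.1 x.2.1)) a j *
            (if b (f (x.2.2 j)) (xs j) = as j then (1 : ℝ) else 0)| ≤ K := by
      intro a _
      have h1 := hu (x.1 x.2.1) (π (x.1 x.2.1)) a
      have h2 : |∑ j, lam (π (x.1 x.2.1)) a j *
            (if b (f (x.2.2 j)) (xs j) = as j then (1 : ℝ) else 0)| ≤ K := by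
        refine (Finset.abs_sum_le_sum_abs _ _).trans ?_
        refine (Finset.sum_le_card_nsmul _ _ 1 fun j _ => ?_).trans (by simp)
        have h3 := abs_le.2 (hlam (π (x.1 x.2.1)) a j)
        split_ifs
        · simpa using h3
        · simp
      rw [abs_mul, abs_of_nonneg h1.1]
      exact (mul_le_of_le_one_left (abs_nonneg _) h1.2).trans h2
    refine (Finset.sum_le_card_nsmul _ _ _ this).trans ?_
    simp [mul_comm]
end

section
/- Full-feedback stochastic-context theorem (conditional on the Hedge guarantee): Let Z_1, …, Z_T be i.i.d. with law μ on Z and f_t = φ_t(Z_1, …, Z_{t−1}) ∈ {1, …, K} for fixed measurable functions φ_t. For each z let E_z ⊆ X be finite nonempty, let Ω_T = {ω ∈ Δ^K : T·ω_i ∈ ℕ}, and let Π = {π^(ω) : ω ∈ Ω_T} where π^(ω)(z) ∈ argmax_{x ∈ E_z} Σ_{i=1}^K ω_i·u(z, x, b_i(z, x)). Write u_t(π) = u(Z_t, π(Z_t), b_{f_t}(Z_t, π(Z_t))) ∈ [0,1]. Suppose the leader's (random) distributions p_t over Π satisfy, for every realization, the Hedge regret guarantee Σ_{t=1}^T Σ_{π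 ∈ Π} p_t[π]·u_t(π) ≥ max_{π ∈ Π} Σ_{t=1}^T u_t(π) − 2·√(T·log|Π|). Then for every policy π̄ with π̄(z) ∈ E_z for all z (and all relevant maps measurable): E[Σ_{t=1}^T u_t(π̄) − Σ_{t=1}^T Σ_{π ∈ Π} p_t[π]·u_t(π)] ≤ 2K + 2·√(T·K·log(T+1)). -/
open MeasureTheory Finset

/-- The grid `Ω_T` of the `K`-simplex, indexed by integer vectors `n` with `Σ n_i = T`
(the corresponding grid point is `ω_i = n_i / T`). -/
def SimplexGrid (K T : ℕ) : Type := {n : Fin K → Fin (T + 1) // ∑ i, (n i : ℕ) = T}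

instance (K T : ℕ) : Fintype (SimplexGrid K T) :=
  Subtype.fintype _

/-- The grid point of the `K`-simplex associated with an index `n ∈ SimplexGrid K T`. -/
noncomputable def gridPoint {K T : ℕ} (n : SimplexGrid K T) : Fin K → ℝ :=
  fun i => (n.1 i : ℝ) / T

open ProbabilityTheory in
lemma key_indep {Z : Type*} [MeasurableSpace Z]
    (μ : Measure Z) [IsProbabilityMeasure μ] (T K : ℕ)
    (f : (Fin T → Z) → Fin K) (t : Fin T) (hf : Measurable f)
    (hpast : ∀ ω ω', (∀ s, s < t → ω s = ω' s) → f ω = f ω')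
    (g : Z → ℝ) (hg : Measurable g) (i : Fin K) :
    ∫ ω, (if f ω = i then (1:ℝ) else 0) * g (ω t) ∂(Measure.pi fun _ : Fin T => μ)
      = (∫ ω, (if f ω = i then (1:ℝ) else 0) ∂(Measure.pi fun _ : Fin T => μ)) * ∫ z, g z ∂μ := by
  obtain ⟨z0⟩ : Nonempty Z := nonempty_of_isProbabilityMeasure μ
  have hind : iIndepFun (fun (s : Fin T) (ω : Fin T → Z) => ω s) (Measure.pi fun _ : Fin T => μ) :=
    iIndepFun_pi (X := fun _ (z : Z) => z) (fun _ => aemeasurable_id)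
  have h2 := hind.indepFun_finset (Finset.Iio t) {t} (by simp) (fun s => measurable_pi_apply s)
  let ext : ((Finset.Iio t) → Z) → (Fin T → Z) :=
    fun x s => if h : s ∈ Finset.Iio t then x ⟨s, h⟩ else z0
  have hext : Measurable ext := by
    refine measurable_pi_lambda _ fun s => ?_
    by_cases h : s ∈ Finset.Iio t
    · simp only [ext, h, dite_true]; exact measurable_pi_apply _
    · simp only [ext, h, dite_false]; exact measurable_const
  have hφ1 : Measurable (fun x : (Finset.Iio t) → Z => if f (ext x) = i then (1:ℝ) else 0) :=
    Measurable.ite ((hf.comp hext) (measurableSet_singleton i)) measurable_const measurable_const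
  have hφ2 : Measurable (fun y : ({t} : Finset (Fin T)) → Z => g (y ⟨t, by simp⟩)) :=
    hg.comp (measurable_pi_apply _)
  have h3 := h2.comp hφ1 hφ2
  have hm1 : Measurable (fun ω => if f ω = i then (1:ℝ) else 0) :=
    Measurable.ite (hf (measurableSet_singleton i)) measurable_const measurable_const
  have hm2 : Measurable (fun ω : Fin T → Z => g (ω t)) := hg.comp (measurable_pi_apply t)
  have e1 : ((fun x : (Finset.Iio t) → Z => if f (ext x) = i then (1:ℝ) else 0) ∘
      fun (a : Fin T → Z) (s : Finset.Iio t) => a s) = fun ω => if f ω = i then (1:ℝ) else 0 := by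
    funext ω
    have : f (ext fun s => ω s) = f ω := hpast _ _ (fun s hs => by simp [ext, hs])
    simp [this]
  rw [e1] at h3
  have h4 : IndepFun (fun ω => if f ω = i then (1:ℝ) else 0) (fun ω : Fin T → Z => g (ω t))
    (Measure.pi fun _ : Fin T => μ) := h3
  rw [h4.integral_fun_mul_eq_mul_integral hm1.aestronglyMeasurable hm2.aestronglyMeasurable]
  congr 1
  have hmp := measurePreserving_eval (fun _ : Fin T => μ) t
  have h5 := integral_map (μ := Measure.pi fun _ : Fin T => μ) hmp.measurable.aemeasurable
    (f := g) hg.aestronglyMeasurable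
  rw [hmp.map_eq] at h5
  exact h5.symm

lemma round_grid (K T : ℕ) (c : Fin K → ℝ) (hc : ∀ i, 0 ≤ c i) (hs : ∑ i, c i = T) :
    ∃ n : SimplexGrid K T, ∀ i, |c i - (n.1 i : ℝ)| ≤ 1 := by
  have hle : ∑ i, ⌊c i⌋₊ ≤ T := by
    have : ((∑ i, ⌊c i⌋₊ : ℕ) : ℝ) ≤ T := by
      rw [← hs]; push_cast; exact Finset.sum_le_sum fun i _ => Nat.floor_le (hc i)
    exact_mod_cast this
  have hge : T ≤ ∑ i, ⌊c i⌋₊ + K := by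
    have : (T : ℝ) ≤ ((∑ i, ⌊c i⌋₊ + K : ℕ) : ℝ) := by
      rw [← hs]; push_cast
      calc ∑ i, c i ≤ ∑ i, ((⌊c i⌋₊ : ℝ) + 1) :=
            Finset.sum_le_sum fun i _ => (Nat.lt_floor_add_one (c i)).le
        _ = _ := by simp [Finset.sum_add_distrib]
    exact_mod_cast this
  obtain ⟨S, -, hS⟩ := Finset.exists_subset_card_eq (s := (Finset.univ : Finset (Fin K)))
    (n := T - ∑ i, ⌊c i⌋₊) (by simp; omega)
  let m : Fin K → ℕ := fun i => ⌊c i⌋₊ + if i ∈ S then 1 else 0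
  have hm : ∑ i, m i = T := by
    simp only [m, Finset.sum_add_distrib]
    simp [hS]; omega
  have hmle : ∀ i, m i < T + 1 := fun i => by
    have := Finset.single_le_sum (f := m) (fun j _ => Nat.zero_le _) (Finset.mem_univ i)
    omega
  refine ⟨⟨fun i => ⟨m i, hmle i⟩, hm⟩, fun i => ?_⟩
  have h1 := Nat.floor_le (hc i)
  have h2 := Nat.lt_floor_add_one (c i)
  simp only [m]
  rw [abs_le]
  split_ifs <;> push_cast <;> constructor <;> linarith

/-- **Full-feedback stochastic-context theorem (conditional on the Hedge guarantee).**
Let `Z_1, …, Z_T` be i.i.d. with law `μ` (coordinates of `ω : Fin T → Z` under the product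
measure) and let the adversary's types `f_t = φ t ω` be measurable functions of the
coordinates `ω s`, `s < t` only.  For each `z` let `E z ⊆ X` be finite nonempty, and for
each grid point `w ∈ Ω_T = {w ∈ Δ^K : T·w_i ∈ ℕ}` let `πsel w` satisfy
`πsel w z ∈ argmax_{x ∈ E z} Σ_i w_i · u(z, x, b_i(z, x))`; the policy class is
`Π = {πsel (gridPoint n) : n ∈ SimplexGrid K T}`.  Write
`u_t(π) = u(Z_t, π(Z_t), b_{f_t}(Z_t, π(Z_t))) ∈ [0,1]`.  Suppose the leader's (random)
distributions `p t` over `Π` satisfy, for every realization `ω` and every `π ∈ Π`, the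
Hedge regret guarantee
`Σ_t Σ_π p_t[π]·u_t(π) ≥ Σ_t u_t(π) − 2·√(T·log |Π|)`.
Then for every policy `πbar` with `πbar z ∈ E z` for all `z` (all relevant maps
measurable):
`E[Σ_t u_t(πbar) − Σ_t Σ_π p_t[π]·u_t(π)] ≤ 2K + 2·√(T·K·log(T+1))`. -/
theorem stmt19 {Z X Af : Type*} [MeasurableSpace Z] [Fintype Af]
    (μ : Measure Z) [IsProbabilityMeasure μ]
    (T K : ℕ) (hT : 1 ≤ T) (hK : 1 ≤ K)
    (φ : Fin T → (Fin T → Z) → Fin K)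
    (hφ_meas : ∀ t, Measurable (φ t))
    (hφ_past : ∀ t ω ω', (∀ s, s < t → ω s = ω' s) → φ t ω = φ t ω')
    (b : Fin K → Z → X → Af)
    (u : Z → X → Af → ℝ) (hu : ∀ z x a, u z x a ∈ Set.Icc (0 : ℝ) 1)
    (E : Z → Finset X) (hE : ∀ z, (E z).Nonempty)
    (πsel : (Fin K → ℝ) → Z → X)
    (hπsel : ∀ w : Fin K → ℝ,
      ((∀ i, 0 ≤ w i) ∧ (∑ i, w i = 1) ∧ (∀ i, ∃ m : ℕ, (T : ℝ) * w i = m)) →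
      ∀ z, πsel w z ∈ E z ∧
        ∀ x ∈ E z, (∑ i, w i * u z x (b i z x)) ≤
          ∑ i, w i * u z (πsel w z) (b i z (πsel w z)))
    (hπsel_meas : ∀ w i, Measurable fun z => u z (πsel w z) (b i z (πsel w z)))
    (πbar : Z → X) (hπbar : ∀ z, πbar z ∈ E z)
    (hπbar_meas : ∀ i, Measurable fun z => u z (πbar z) (b i z (πbar z)))
    (p : Fin T → (Fin T → Z) → SimplexGrid K T → ℝ)
    (hp_prob : ∀ t ω, (∀ n, 0 ≤ p t ω n) ∧ (∑ n, p t ω n = 1))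
    (hp_meas : ∀ t n, Measurable fun ω => p t ω n)
    (hhedge : ∀ ω : Fin T → Z, ∀ n : SimplexGrid K T,
      (∑ t, u (ω t) (πsel (gridPoint n) (ω t)) (b (φ t ω) (ω t) (πsel (gridPoint n) (ω t))))
          - 2 * Real.sqrt (T * Real.log (Fintype.card (SimplexGrid K T)))
        ≤ ∑ t, ∑ n' : SimplexGrid K T, p t ω n' *
            u (ω t) (πsel (gridPoint n') (ω t)) (b (φ t ω) (ω t) (πsel (gridPoint n') (ω t)))) :
    (∫ ω, ((∑ t, u (ω t) (πbar (ω t)) (b (φ t ω) (ω t) (πbar (ω t))))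
          - ∑ t, ∑ n : SimplexGrid K T, p t ω n *
              u (ω t) (πsel (gridPoint n) (ω t)) (b (φ t ω) (ω t) (πsel (gridPoint n) (ω t))))
        ∂(Measure.pi fun _ : Fin T => μ))
      ≤ 2 * K + 2 * Real.sqrt (T * K * Real.log (T + 1)) := by
  classical
  set P := (Measure.pi fun _ : Fin T => μ) with hP
  have hT0 : (T : ℝ) ≠ 0 := by positivity
  have hTpos : (0 : ℝ) < T := by positivity
  let I : Fin T → Fin K → (Fin T → Z) → ℝ := fun t i ω => if φ t ω = i then (1:ℝ) else 0
  have hI_meas : ∀ t i, Measurable (I t i) := fun t i =>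
    Measurable.ite ((hφ_meas t) (measurableSet_singleton i)) measurable_const measurable_const
  have hI_01 : ∀ t i ω, 0 ≤ I t i ω ∧ I t i ω ≤ 1 := fun t i ω => by
    simp only [I]; split_ifs <;> simp
  have hI_int : ∀ t i, Integrable (I t i) P := fun t i =>
    Integrable.of_bound (hI_meas t i).aestronglyMeasurable 1 (Filter.Eventually.of_forall fun ω => by
      rw [Real.norm_eq_abs, abs_of_nonneg (hI_01 t i ω).1]; exact (hI_01 t i ω).2)
  -- reward of a policy
  let R : (Z → X) → Fin T → (Fin T → Z) → ℝ := fun π t ω =>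
    u (ω t) (π (ω t)) (b (φ t ω) (ω t) (π (ω t)))
  let G : (Z → X) → Fin K → Z → ℝ := fun π i z => u z (π z) (b i z (π z))
  have hR_eq : ∀ π t ω, R π t ω = ∑ i, I t i ω * G π i (ω t) := fun π t ω => by
    simp [I, R, G]
  have hR_meas : ∀ π, (∀ i, Measurable (G π i)) → ∀ t, Measurable (R π t) := fun π h t => by
    have : R π t = fun ω => ∑ i, I t i ω * G π i (ω t) := funext (hR_eq π t)
    rw [this]
    exact Finset.measurable_sum _ fun i _ =>
      (hI_meas t i).mul ((h i).comp (measurable_pi_apply t))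
  have hR_int : ∀ π, (∀ i, Measurable (G π i)) → ∀ t, Integrable (R π t) P := fun π h t =>
    Integrable.of_bound (hR_meas π h t).aestronglyMeasurable 1
      (Filter.Eventually.of_forall fun ω => by
        have := hu (ω t) (π (ω t)) (b (φ t ω) (ω t) (π (ω t)))
        rw [Real.norm_eq_abs, abs_of_nonneg this.1]; exact this.2)
  have hG_int : ∀ π, (∀ i, Measurable (G π i)) → ∀ i, Integrable (G π i) μ := fun π h i =>
    Integrable.of_bound (h i).aestronglyMeasurable 1
      (Filter.Eventually.of_forall fun z => by
        have := hu z (π z) (b i z (π z))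
        rw [Real.norm_eq_abs, abs_of_nonneg this.1]; exact this.2)
  let c : Fin K → ℝ := fun i => ∑ t, ∫ ω, I t i ω ∂P
  have hER : ∀ π, (∀ i, Measurable (G π i)) →
      ∫ ω, ∑ t, R π t ω ∂P = ∑ i, c i * ∫ z, G π i z ∂μ := fun π h => by
    rw [integral_finsetSum _ fun t _ => hR_int π h t]
    simp only [c, Finset.sum_mul]
    rw [Finset.sum_comm]
    refine Finset.sum_congr rfl fun t _ => ?_
    simp only [hR_eq]
    rw [integral_finsetSum]
    · exact Finset.sum_congr rfl fun i _ =>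
        key_indep μ T K (φ t) t (hφ_meas t) (hφ_past t) (G π i) (h i) i
    · intro i _
      refine Integrable.of_bound ((hI_meas t i).mul
        ((h i).comp (measurable_pi_apply t))).aestronglyMeasurable 1
        (Filter.Eventually.of_forall fun ω => ?_)
      have h1 := hu (ω t) (π (ω t)) (b i (ω t) (π (ω t)))
      have h2 := hI_01 t i ω
      rw [Real.norm_eq_abs, abs_of_nonneg (mul_nonneg h2.1 h1.1)]
      exact mul_le_one₀ h2.2 h1.1 h1.2
  have hc0 : ∀ i, 0 ≤ c i := fun i =>
    Finset.sum_nonneg fun t _ => integral_nonneg fun ω => (hI_01 t i ω).1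
  have hcs : ∑ i, c i = T := by
    simp only [c]
    rw [Finset.sum_comm]
    have : ∀ t, ∑ i, ∫ ω, I t i ω ∂P = 1 := fun t => by
      rw [← integral_finsetSum _ fun i _ => hI_int t i]
      simp [I]
    simp [this]
  obtain ⟨n, hn⟩ := round_grid K T c hc0 hcs
  have hsel := hπsel (gridPoint n) ⟨fun i => by unfold gridPoint; positivity, by
      have := n.2
      simp only [gridPoint]
      rw [← Finset.sum_div, div_eq_one_iff_eq hT0]
      exact_mod_cast this, fun i => ⟨n.1 i, by simp only [gridPoint]; field_simp⟩⟩
  set πs := πsel (gridPoint n) with hπs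
  have hsm : ∀ i, Measurable (G πs i) := hπsel_meas (gridPoint n)
  have hbm : ∀ i, Measurable (G πbar i) := hπbar_meas
  -- optimality of πs for the grid weights
  have hopt : ∑ i, (n.1 i : ℝ) * ∫ z, G πbar i z ∂μ ≤ ∑ i, (n.1 i : ℝ) * ∫ z, G πs i z ∂μ := by
    have e : ∀ π, (∀ i, Measurable (G π i)) → ∑ i, (n.1 i : ℝ) * ∫ z, G π i z ∂μ
        = ∫ z, ∑ i, (n.1 i : ℝ) * G π i z ∂μ := fun π h => by
      rw [integral_finsetSum _ fun i _ => (hG_int π h i).const_mul _]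
      simp only [integral_const_mul]
    rw [e _ hsm, e _ hbm]
    refine integral_mono (integrable_finsetSum _ fun i _ => (hG_int _ hbm i).const_mul _)
      (integrable_finsetSum _ fun i _ => (hG_int _ hsm i).const_mul _) fun z => ?_
    have h := (hsel z).2 (πbar z) (hπbar z)
    have h' := mul_le_mul_of_nonneg_left h hTpos.le
    simp only [Finset.mul_sum, gridPoint] at h'
    have e2 : ∀ (x : ℝ) i, (T : ℝ) * ((n.1 i : ℝ) / T * x) = (n.1 i : ℝ) * x := fun x i => by
      field_simp
    simp only [e2] at h'
    exact h'
  have hU : ∀ π, (∀ i, Measurable (G π i)) → ∀ i, 0 ≤ ∫ z, G π i z ∂μ ∧ ∫ z, G π i z ∂μ ≤ 1 :=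
    fun π h i => ⟨integral_nonneg fun z => (hu _ _ _).1, by
      have := integral_mono (hG_int π h i) (integrable_const (1:ℝ)) (fun z => (hu _ _ _).2)
      simpa using this⟩
  have hdiff : ∑ i, c i * ∫ z, G πbar i z ∂μ - ∑ i, c i * ∫ z, G πs i z ∂μ ≤ K := by
    have h1 : ∑ i, (c i - (n.1 i : ℝ)) * (∫ z, G πbar i z ∂μ - ∫ z, G πs i z ∂μ) ≤ ∑ _i : Fin K, (1:ℝ) := by
      refine Finset.sum_le_sum fun i _ => ?_
      refine (le_abs_self _).trans ?_
      rw [abs_mul]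
      refine mul_le_one₀ (hn i) (abs_nonneg _) ?_
      have a := hU _ hbm i
      have b := hU _ hsm i
      rw [abs_le]; constructor <;> linarith
    simp only [sub_mul, mul_sub, Finset.sum_sub_distrib] at h1
    simp at h1
    linarith
  let H : (Fin T → Z) → ℝ := fun ω => ∑ t, ∑ n' : SimplexGrid K T, p t ω n' *
    R (πsel (gridPoint n')) t ω
  have hp1 : ∀ t ω n', p t ω n' ≤ 1 := fun t ω n' => by
    rw [← (hp_prob t ω).2]
    exact Finset.single_le_sum (f := p t ω) (fun j _ => (hp_prob t ω).1 j) (Finset.mem_univ n')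
  have hH_int : Integrable H P := by
    refine integrable_finsetSum _ fun t _ => integrable_finsetSum _ fun n' _ => ?_
    refine Integrable.of_bound ((hp_meas t n').mul
        (hR_meas _ (hπsel_meas (gridPoint n')) t)).aestronglyMeasurable 1
        (Filter.Eventually.of_forall fun ω => ?_)
    have h1 : R (πsel (gridPoint n')) t ω ∈ Set.Icc (0:ℝ) 1 := hu _ _ _
    have h2 := (hp_prob t ω).1 n'
    rw [Real.norm_eq_abs, abs_of_nonneg (mul_nonneg h2 h1.1)]
    exact mul_le_one₀ (hp1 t ω n') h1.1 h1.2
  have hSb : Integrable (fun ω => ∑ t, R πbar t ω) P :=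
    integrable_finsetSum _ fun t _ => hR_int _ hbm t
  have hSs : Integrable (fun ω => ∑ t, R πs t ω) P :=
    integrable_finsetSum _ fun t _ => hR_int _ hsm t
  have hgoal : ∫ ω, ((∑ t, R πbar t ω) - H ω) ∂P
      ≤ 2 * K + 2 * Real.sqrt (T * K * Real.log (T + 1)) := by
    rw [integral_sub hSb hH_int, hER _ hbm]
    have hh : ∫ ω, ((∑ t, R πs t ω) - 2 * Real.sqrt (T * Real.log (Fintype.card (SimplexGrid K T)))) ∂P
        ≤ ∫ ω, H ω ∂P :=
      integral_mono (hSs.sub (integrable_const _)) hH_int fun ω => hhedge ω n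
    rw [integral_sub hSs (integrable_const _), hER _ hsm] at hh
    simp only [integral_const, probReal_univ, one_smul] at hh
    have hcard : Fintype.card (SimplexGrid K T) ≤ (T + 1) ^ K := by
      have := Fintype.card_le_of_injective
        (fun n : SimplexGrid K T => (n.1 : Fin K → Fin (T + 1))) (fun a b h => Subtype.ext h)
      simpa using this
    have hcpos : 0 < Fintype.card (SimplexGrid K T) := Fintype.card_pos_iff.2 ⟨n⟩
    have hlog : Real.log (Fintype.card (SimplexGrid K T)) ≤ K * Real.log (T + 1) := by
      rw [← Real.log_pow]
      exact Real.log_le_log (by exact_mod_cast hcpos) (by exact_mod_cast hcard)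
    have hsq : Real.sqrt (T * Real.log (Fintype.card (SimplexGrid K T)))
        ≤ Real.sqrt (T * K * Real.log (T + 1)) := by
      apply Real.sqrt_le_sqrt
      rw [mul_assoc]
      exact mul_le_mul_of_nonneg_left hlog hTpos.le
    have hK0 : (0:ℝ) ≤ K := by positivity
    linarith
  exact hgoal
end
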